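/- arXiv:1512.07906 — 6 statements merged into one kernel-verified Lean document; each statement's English description precedes it below -/
import Mathlib

section
/- Fix integers n ≥ 2 and b ≥ 1 such that (n−1−b)/2 is not a positive integer, and set b̃ = b−1. Define for integers N ≥ 2 and 1 ≤ k ≤ N−1 the real number f(N,k) = 4 · (sin((((n−2+b̃)/2)+k)·π/(N+b̃)) / sin(k·π/(N+b̃))) · sin((k+b̃)·π/(N+b̃)) · sin((k−(n−2−b̃)/2)·π/(N+b̃)), g(N,j) = ∏_{k=1}^{j} f(N,k) for 1 ≤ j ≤ N−1, and P(N) = 1 + ∑_{j=1}^{N−1} g(N,j). Then lim_{N→∞} (2π/N) · log|P(N)| = 4∫_0^{5π/6} log(2 sin t) dt. -/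
open Filter Finset

/-- The `k`-th factor `f(N,k)` in the real product form of the SU(n)-specialized
superpolynomial of the figure-eight knot at the root of unity `q = e^{πi/(N+b̃)}`,
where `b̃ = b - 1`. -/
noncomputable def f (n b : ℤ) (N k : ℕ) : ℝ :=
  4 * (Real.sin (((((n : ℝ) - 2 + ((b : ℝ) - 1)) / 2) + (k : ℝ)) * Real.pi /
          ((N : ℝ) + ((b : ℝ) - 1))) /
        Real.sin ((k : ℝ) * Real.pi / ((N : ℝ) + ((b : ℝ) - 1)))) *
    Real.sin (((k : ℝ) + ((b : ℝ) - 1)) * Real.pi / ((N : ℝ) + ((b : ℝ) - 1))) *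
    Real.sin (((k : ℝ) - ((n : ℝ) - 2 - ((b : ℝ) - 1)) / 2) * Real.pi /
      ((N : ℝ) + ((b : ℝ) - 1)))

noncomputable def g (n b : ℤ) (N j : ℕ) : ℝ := ∏ k ∈ Finset.Icc 1 j, f n b N k

noncomputable def P (n b : ℤ) (N : ℕ) : ℝ := 1 + ∑ j ∈ Finset.Icc 1 (N - 1), g n b N j

theorem aux_sin_lower {x θ : ℝ} (h0 : 0 ≤ θ) (h1 : θ ≤ x) (h2 : x ≤ Real.pi - θ) :
    2 / Real.pi * θ ≤ Real.sin x := by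
  have hp := Real.pi_pos
  have h3 : 0 < 2 / Real.pi := by positivity
  rcases le_total x (Real.pi / 2) with h | h
  · refine le_trans ?_ (Real.mul_le_sin (by linarith) h)
    gcongr
  · rw [← Real.sin_pi_sub]
    refine le_trans ?_ (Real.mul_le_sin (by linarith) (by linarith))
    gcongr
    linarith

theorem aux_unif (a β c : ℝ) : ∃ C : ℝ, 0 < C ∧ ∀ θ x : ℝ, 0 < θ → θ ≤ x → x ≤ Real.pi - θ →
    |4 * (Real.sin (x + a * θ) / Real.sin x) * Real.sin (x + β * θ) * Real.sin (x - c * θ)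
      - 4 * Real.sin x ^ 2| ≤ C * θ := by
  have hp := Real.pi_pos
  refine ⟨4 * (|c| + |a| + (1 + |a| * (Real.pi / 2)) * |β|) + 1, by positivity, ?_⟩
  intro θ x h0 h1 h2
  have hl := aux_sin_lower h0.le h1 h2
  have hs : 0 < Real.sin x := lt_of_lt_of_le (by positivity) hl
  have ea : |Real.sin (x + a * θ) - Real.sin x| ≤ |a| * θ := by
    refine (Real.abs_sin_sub_sin_le _ _).trans ?_
    rw [add_sub_cancel_left, abs_mul, abs_of_pos h0]
  have eb : |Real.sin (x + β * θ) - Real.sin x| ≤ |β| * θ := by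
    refine (Real.abs_sin_sub_sin_le _ _).trans ?_
    rw [add_sub_cancel_left, abs_mul, abs_of_pos h0]
  have ec : |Real.sin (x - c * θ) - Real.sin x| ≤ |c| * θ := by
    refine (Real.abs_sin_sub_sin_le _ _).trans ?_
    rw [sub_sub_cancel_left, abs_neg, abs_mul, abs_of_pos h0]
  have hR : |Real.sin (x + a * θ) / Real.sin x| ≤ 1 + |a| * (Real.pi / 2) := by
    rw [abs_div, abs_of_pos hs, div_le_iff₀ hs]
    have h5 : |Real.sin (x + a * θ)| ≤ Real.sin x + |a| * θ := by
      have := abs_sub_abs_le_abs_sub (Real.sin (x + a * θ)) (Real.sin x)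
      rw [abs_of_pos hs] at this
      linarith
    have h6 : θ ≤ Real.pi / 2 * Real.sin x := by
      have : Real.pi / 2 * (2 / Real.pi * θ) ≤ Real.pi / 2 * Real.sin x := by gcongr
      have e : Real.pi / 2 * (2 / Real.pi * θ) = θ := by field_simp
      linarith
    nlinarith [mul_le_mul_of_nonneg_left h6 (abs_nonneg a)]
  set R := Real.sin (x + a * θ) / Real.sin x with hRd
  have hRs : R * Real.sin x = Real.sin (x + a * θ) := by
    rw [hRd]; field_simp
  set sa := Real.sin (x + a * θ)
  set sb := Real.sin (x + β * θ)
  set sc := Real.sin (x - c * θ) with hsc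
  set s := Real.sin x with hsd
  have e1 : 4 * R * sb * sc - 4 * s ^ 2 =
      4 * (s * (sc - s) + (sa - s) * sc + R * (sb - s) * sc) := by
    linear_combination 4 * sc * hRs
  have b1 : |s| ≤ 1 := Real.abs_sin_le_one _
  have b2 : |sc| ≤ 1 := Real.abs_sin_le_one _
  rw [e1, abs_mul, abs_of_pos (by norm_num : (0:ℝ) < 4)]
  have t1 : |s * (sc - s)| ≤ |c| * θ := by
    rw [abs_mul]
    calc _ ≤ 1 * (|c| * θ) := by gcongr
      _ = _ := one_mul _
  have t2 : |(sa - s) * sc| ≤ |a| * θ := by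
    rw [abs_mul]
    calc _ ≤ (|a| * θ) * 1 := by gcongr
      _ = _ := mul_one _
  have t3 : |R * (sb - s) * sc| ≤ (1 + |a| * (Real.pi / 2)) * (|β| * θ) := by
    rw [abs_mul, abs_mul]
    calc _ ≤ (1 + |a| * (Real.pi / 2)) * (|β| * θ) * 1 := by gcongr
      _ = _ := mul_one _
  have t4 := abs_add_three (s * (sc - s)) ((sa - s) * sc) (R * (sb - s) * sc)
  nlinarith

theorem aux_log {z r : ℝ} (h : |z - 1| ≤ r) (hr : r ≤ 1 / 2) : 0 < z ∧ |Real.log z| ≤ 2 * r := by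
  obtain ⟨h1, h2⟩ := abs_le.1 h
  have hz : 0 < z := by linarith
  refine ⟨hz, abs_le.2 ⟨?_, ?_⟩⟩
  · have := Real.one_sub_inv_le_log_of_pos hz
    have h3 : z⁻¹ ≤ 1 + 2 * r := by
      rw [inv_le_comm₀ hz (by linarith), inv_le_iff_one_le_mul₀ (by linarith)]
      nlinarith
    linarith
  · have := Real.log_le_sub_one_of_pos hz
    linarith

theorem aux_sin_six {x : ℝ} (h0 : 0 ≤ x) (h1 : x ≤ 5 * Real.pi / 6) : x / 6 ≤ Real.sin x := by
  have hp := Real.pi_pos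
  have hp4 := Real.pi_lt_d2
  rcases le_total x (Real.pi / 2) with h | h
  · refine le_trans ?_ (Real.mul_le_sin h0 h)
    rw [div_mul_eq_mul_div, div_le_div_iff₀ (by norm_num) hp]
    nlinarith
  · have : Real.sin (Real.pi / 6) ≤ Real.sin (Real.pi - x) := by
      apply Real.sin_le_sin_of_le_of_le_pi_div_two <;> linarith
    rw [Real.sin_pi_div_six, Real.sin_pi_sub] at this
    linarith

theorem aux_logsin {x y η : ℝ} (h0 : 0 < x) (h1 : x ≤ 5 * Real.pi / 6) (hη : η ≤ 1 / 12)
    (hy : |y - x| ≤ η * x) :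
    0 < Real.sin y ∧ |Real.log (Real.sin y) - Real.log (Real.sin x)| ≤ 12 * η := by
  have hs6 := aux_sin_six h0.le h1
  have hs : 0 < Real.sin x := lt_of_lt_of_le (by positivity) hs6
  have hη0 : 0 ≤ η := by
    by_contra hneg
    have := abs_nonneg (y - x)
    nlinarith
  have h2 : |Real.sin y / Real.sin x - 1| ≤ 6 * η := by
    rw [div_sub_one hs.ne', abs_div, abs_of_pos hs, div_le_iff₀ hs]
    have := Real.abs_sin_sub_sin_le y x
    nlinarith
  obtain ⟨h3, h4⟩ := aux_log h2 (by linarith)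
  have hsy : 0 < Real.sin y := by
    have := mul_pos h3 hs
    rwa [div_mul_cancel₀ _ hs.ne'] at this
  refine ⟨hsy, ?_⟩
  rw [← Real.log_div hsy.ne' hs.ne']
  linarith

/-- the k-th factor, abstractly -/
noncomputable def auxF (a β c θ : ℝ) (k : ℝ) : ℝ :=
  4 * (Real.sin (k * θ + a * θ) / Real.sin (k * θ)) * Real.sin (k * θ + β * θ)
    * Real.sin (k * θ - c * θ)

noncomputable def auxH (t : ℝ) : ℝ := Real.log 2 + Real.log (Real.sin t)

theorem auxH_int (x y : ℝ) : IntervalIntegrable auxH MeasureTheory.volume x y := by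
  unfold auxH
  exact intervalIntegrable_const.add (intervalIntegrable_log_sin)

theorem auxH_eq : ∫ t in (0:ℝ)..(5 * Real.pi / 6), Real.log (2 * Real.sin t)
    = ∫ t in (0:ℝ)..(5 * Real.pi / 6), auxH t := by
  have hp := Real.pi_pos
  apply intervalIntegral.integral_congr_ae
  refine Filter.Eventually.of_forall fun t ht => ?_
  rw [Set.uIoc_of_le (by positivity)] at ht
  have : 0 < Real.sin t := Real.sin_pos_of_pos_of_lt_pi ht.1 (by linarith [ht.2])
  rw [auxH, Real.log_mul (by norm_num) this.ne']

theorem auxH_pos : 0 < ∫ t in (0:ℝ)..(5 * Real.pi / 6), auxH t := by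
  have hp := Real.pi_pos
  have h1 : ∫ t in (0:ℝ)..Real.pi, auxH t = 0 := by
    unfold auxH
    rw [intervalIntegral.integral_add intervalIntegrable_const
      (by exact intervalIntegrable_log_sin), integral_log_sin_zero_pi]
    simp
    ring
  have h2 := intervalIntegral.integral_add_adjacent_intervals
    (auxH_int 0 (5 * Real.pi / 6)) (auxH_int (5 * Real.pi / 6) Real.pi)
  have h3 : 0 < ∫ t in (5 * Real.pi / 6)..Real.pi, - auxH t := by
    apply intervalIntegral.intervalIntegral_pos_of_pos_on (auxH_int _ _).neg _ (by linarith)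
    intro t ht
    have hs : 0 < Real.sin t := Real.sin_pos_of_pos_of_lt_pi (by linarith [ht.1]) ht.2
    have hs2 : Real.sin t < 1 / 2 := by
      rw [← Real.sin_pi_sub, ← Real.sin_pi_div_six]
      apply Real.sin_lt_sin_of_lt_of_le_pi_div_two <;> linarith [ht.1, ht.2]
    have h4 := Real.log_neg (x := 2 * Real.sin t) (by positivity) (by linarith)
    have h5 : auxH t < 0 := by
      rw [auxH, ← Real.log_mul (by norm_num) hs.ne']
      exact h4
    simpa using h5
  rw [intervalIntegral.integral_neg] at h3
  linarith

theorem auxH_cont : Continuous fun x : ℝ => ∫ t in (0:ℝ)..x, auxH t :=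
  intervalIntegral.continuous_primitive (fun x y => auxH_int x y) 0

/-- main block estimate -/
theorem aux_pt (a β c : ℝ) {η θ k t : ℝ} (hη : 0 < η) (hη1 : η ≤ 1 / 12) (hθ : 0 < θ) (hk0 : 0 < k)
    (hk : (1 + |a| + |β| + |c|) ≤ η * k) (hk2 : k * θ ≤ 5 * Real.pi / 6)
    (ht : (k - 1) * θ ≤ t) (ht2 : t ≤ k * θ) :
    |Real.log |auxF a β c θ k| - 2 * auxH t| ≤ 60 * η := by
  have hx : 0 < k * θ := by positivity
  have na := abs_nonneg a
  have nb := abs_nonneg β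
  have nc := abs_nonneg c
  have key : ∀ s : ℝ, |s| ≤ 1 + |a| + |β| + |c| → |s * θ| ≤ η * (k * θ) := by
    intro s hs
    rw [abs_mul, abs_of_pos hθ, ← mul_assoc]
    gcongr
    linarith
  obtain ⟨pa, la⟩ := aux_logsin (y := k * θ + a * θ) hx hk2 hη1
    (by rw [add_sub_cancel_left]; exact key a (by linarith))
  obtain ⟨pb, lb⟩ := aux_logsin (y := k * θ + β * θ) hx hk2 hη1
    (by rw [add_sub_cancel_left]; exact key β (by linarith))
  obtain ⟨pc, lc⟩ := aux_logsin (y := k * θ - c * θ) hx hk2 hη1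
    (by rw [sub_sub_cancel_left, abs_neg]; exact key c (by linarith))
  obtain ⟨pt, lt⟩ := aux_logsin (y := t) hx hk2 hη1 (by
    have := key 1 (by rw [abs_one]; linarith)
    rw [abs_of_pos (by linarith)] at this
    rw [abs_le]; constructor <;> linarith)
  obtain ⟨p0, -⟩ := aux_logsin (y := k * θ) hx hk2 hη1 (by rw [sub_self, abs_zero]; positivity)
  have e : Real.log |auxF a β c θ k| = 2 * Real.log 2 + Real.log (Real.sin (k * θ + a * θ))
      - Real.log (Real.sin (k * θ)) + Real.log (Real.sin (k * θ + β * θ))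
      + Real.log (Real.sin (k * θ - c * θ)) := by
    rw [auxF, Real.log_abs, Real.log_mul (by positivity) pc.ne', Real.log_mul (by positivity) pb.ne',
      Real.log_mul (by norm_num) (by positivity), Real.log_div pa.ne' p0.ne',
      show (4:ℝ) = 2 ^ 2 by norm_num, Real.log_pow]
    ring
  rw [e, auxH]
  rw [abs_le] at *
  constructor <;> linarith [la.1, la.2, lb.1, lb.2, lc.1, lc.2, lt.1, lt.2]

theorem aux_block (a β c : ℝ) {η θ : ℝ} (hη : 0 < η) (hη1 : η ≤ 1 / 12) (hθ : 0 < θ) {K J : ℕ}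
    (hK : (1 + |a| + |β| + |c|) ≤ η * K) (hKJ : K ≤ J) (hJ : J * θ ≤ 5 * Real.pi / 6) :
    |θ * ∑ k ∈ Finset.Ico K J, Real.log |auxF a β c θ ((k + 1 : ℕ) : ℝ)|
      - 2 * ∫ t in (K * θ)..(J * θ), auxH t| ≤ 60 * η * (J * θ) := by
  have h1 := intervalIntegral.sum_integral_adjacent_intervals_Ico (f := auxH)
    (μ := MeasureTheory.volume) (a := fun k : ℕ => (k : ℝ) * θ) hKJ (fun k _ => auxH_int _ _)
  rw [← h1, Finset.mul_sum, Finset.mul_sum, ← Finset.sum_sub_distrib]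
  refine (Finset.abs_sum_le_sum_abs _ _).trans ?_
  have h2 : ∀ k ∈ Finset.Ico K J, |θ * Real.log |auxF a β c θ ((k + 1 : ℕ) : ℝ)|
      - 2 * ∫ t in ((k : ℝ) * θ)..(((k + 1 : ℕ) : ℝ) * θ), auxH t| ≤ 60 * η * θ := by
    intro k hk
    rw [Finset.mem_Ico] at hk
    have hkK : (K : ℝ) ≤ k := by exact_mod_cast hk.1
    have hkJ : ((k + 1 : ℕ) : ℝ) ≤ J := by exact_mod_cast hk.2
    have e : θ * Real.log |auxF a β c θ ((k + 1 : ℕ) : ℝ)|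
      - 2 * ∫ t in ((k : ℝ) * θ)..(((k + 1 : ℕ) : ℝ) * θ), auxH t =
      ∫ t in ((k : ℝ) * θ)..(((k + 1 : ℕ) : ℝ) * θ),
        (Real.log |auxF a β c θ ((k + 1 : ℕ) : ℝ)| - 2 * auxH t) := by
      rw [intervalIntegral.integral_sub intervalIntegrable_const ((auxH_int _ _).const_mul 2),
        intervalIntegral.integral_const, intervalIntegral.integral_const_mul]
      push_cast
      simp only [smul_eq_mul]
      ring
    rw [e]
    have := intervalIntegral.norm_integral_le_of_norm_le_const (a := (k : ℝ) * θ)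
      (b := ((k + 1 : ℕ) : ℝ) * θ) (C := 60 * η)
      (f := fun t => Real.log |auxF a β c θ ((k + 1 : ℕ) : ℝ)| - 2 * auxH t) (by
        intro t ht
        rw [Set.uIoc_of_le (by push_cast; nlinarith)] at ht
        rw [Real.norm_eq_abs]
        apply aux_pt a β c hη hη1 hθ (by positivity)
        · refine hK.trans ?_
          gcongr
          push_cast; linarith
        · refine le_trans ?_ hJ
          gcongr
        · push_cast
          rw [add_sub_cancel_right]
          exact ht.1.le
        · exact ht.2)
    rw [Real.norm_eq_abs] at this
    refine this.trans (le_of_eq ?_)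
    rw [show ((k + 1 : ℕ) : ℝ) * θ - k * θ = θ by push_cast; ring, abs_of_pos hθ]
  refine (Finset.sum_le_card_nsmul _ _ _ h2).trans ?_
  rw [Nat.card_Ico, nsmul_eq_mul, Nat.cast_sub hKJ]
  have : (0:ℝ) ≤ K := by positivity
  nlinarith [mul_pos hη hθ, mul_nonneg this (mul_pos hη hθ).le]
theorem aux_small (a β c k : ℝ) (hk : k ≠ 0) (ha : k + a ≠ 0) (hβ : k + β ≠ 0) (hc : k - c ≠ 0) :
    Filter.Tendsto (fun θ : ℝ => θ * Real.log |auxF a β c θ k|) (nhdsWithin 0 (Set.Ioi 0))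
      (nhds 0) := by
  have hs : ∀ s : ℝ, Filter.Tendsto (fun θ : ℝ => Real.sin (s * θ) / θ)
      (nhdsWithin 0 (Set.Ioi 0)) (nhds s) := by
    intro s
    have h1 : HasDerivAt (fun θ : ℝ => Real.sin (s * θ)) s 0 := by
      have := ((hasDerivAt_id (0:ℝ)).const_mul s).sin
      simpa using this
    have h2 := h1.tendsto_slope_zero_right
    refine h2.congr fun θ => ?_
    simp [div_eq_inv_mul]
  have hlim : Filter.Tendsto (fun θ : ℝ => auxF a β c θ k / θ ^ 2) (nhdsWithin 0 (Set.Ioi 0))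
      (nhds (4 * ((k + a) / k) * (k + β) * (k - c))) := by
    have := ((((hs (k + a)).div (hs k) hk).const_mul 4).mul (hs (k + β))).mul (hs (k - c))
    refine this.congr' ?_
    filter_upwards [self_mem_nhdsWithin] with θ hθ
    have hθ' : θ ≠ 0 := (ne_of_gt hθ)
    simp only [auxF, Pi.div_apply]
    rw [show k * θ + a * θ = (k + a) * θ by ring, show k * θ + β * θ = (k + β) * θ by ring,
      show k * θ - c * θ = (k - c) * θ by ring, div_div_div_cancel_right₀ hθ']
    field_simp
  have hl0 : 4 * ((k + a) / k) * (k + β) * (k - c) ≠ 0 := by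
    refine mul_ne_zero (mul_ne_zero (mul_ne_zero (by norm_num) (div_ne_zero ha hk)) hβ) hc
  have hlog := hlim.log hl0
  have hid : Filter.Tendsto (fun θ : ℝ => θ) (nhdsWithin 0 (Set.Ioi 0)) (nhds 0) :=
    Filter.tendsto_id.mono_left nhdsWithin_le_nhds
  have h3 := (tendsto_log_mul_rpow_nhdsGT_zero (r := 1) one_pos).const_mul 2
  have h4 := (hid.mul hlog).add h3
  simp only [zero_mul, mul_zero, add_zero] at h4
  refine h4.congr' ?_
  filter_upwards [self_mem_nhdsWithin, hlim.eventually_ne hl0] with θ hθ hne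
  have hθ' : θ ≠ 0 := (ne_of_gt hθ)
  have hF : auxF a β c θ k ≠ 0 := by
    intro h0
    rw [h0, zero_div] at hne
    exact hne rfl
  rw [Real.log_div hF (pow_ne_zero _ hθ'), Real.log_pow, Real.rpow_one, Real.log_abs]
  push_cast
  ring

theorem aux_theta : Filter.Tendsto (fun M : ℕ => Real.pi / (M : ℝ)) Filter.atTop
    (nhdsWithin 0 (Set.Ioi 0)) := by
  refine tendsto_nhdsWithin_iff.2 ⟨tendsto_const_div_atTop_nhds_zero_nat _, ?_⟩
  filter_upwards [Filter.eventually_gt_atTop 0] with M hM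
  have : (0:ℝ) < M := by exact_mod_cast hM
  exact div_pos Real.pi_pos this

theorem aux_J : Filter.Tendsto (fun M : ℕ => ((5 * M / 6 : ℕ) : ℝ) * (Real.pi / (M : ℝ)))
    Filter.atTop (nhds (5 * Real.pi / 6)) := by
  have h1 : Filter.Tendsto (fun M : ℕ => 5 * Real.pi / 6 - Real.pi / (M : ℝ)) Filter.atTop
      (nhds (5 * Real.pi / 6)) := by
    have := (tendsto_const_nhds (x := 5 * Real.pi / 6)).sub
      (tendsto_const_div_atTop_nhds_zero_nat Real.pi)
    simpa using this
  have hp := Real.pi_pos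
  refine tendsto_of_tendsto_of_tendsto_of_le_of_le' h1 tendsto_const_nhds ?_ ?_
  · filter_upwards [Filter.eventually_gt_atTop 0] with M hM
    have hM' : (0:ℝ) < M := by exact_mod_cast hM
    have h2 : 5 * M ≤ 6 * (5 * M / 6) + 6 := by omega
    have h3 : (5:ℝ) * M ≤ 6 * ((5 * M / 6 : ℕ) : ℝ) + 6 := by exact_mod_cast h2
    have : 5 * Real.pi / 6 - Real.pi / M = (5 * M - 6) / 6 * (Real.pi / M) := by field_simp
    rw [this]
    gcongr
    linarith
  · filter_upwards [Filter.eventually_gt_atTop 0] with M hM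
    have hM' : (0:ℝ) < M := by exact_mod_cast hM
    have h2 : 6 * (5 * M / 6) ≤ 5 * M := by omega
    have h3 : 6 * ((5 * M / 6 : ℕ) : ℝ) ≤ (5:ℝ) * M := by exact_mod_cast h2
    have : 5 * Real.pi / 6 = (5 * M) / 6 * (Real.pi / M) := by field_simp
    rw [this]
    gcongr
    linarith

theorem aux_J_le (M : ℕ) : ((5 * M / 6 : ℕ) : ℝ) * (Real.pi / (M : ℝ)) ≤ 5 * Real.pi / 6 := by
  have hp := Real.pi_pos
  rcases Nat.eq_zero_or_pos M with rfl | hM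
  · simp; positivity
  have hM' : (0:ℝ) < M := by exact_mod_cast hM
  have h2 : 6 * (5 * M / 6) ≤ 5 * M := by omega
  have h3 : 6 * ((5 * M / 6 : ℕ) : ℝ) ≤ (5:ℝ) * M := by exact_mod_cast h2
  have : 5 * Real.pi / 6 = (5 * M) / 6 * (Real.pi / M) := by field_simp
  rw [this]
  gcongr
  linarith

theorem aux_limit (a β c : ℝ) (ha : 0 ≤ a) (hβ : 0 ≤ β) (hc : ∀ k : ℕ, (k + 1 : ℕ) - c ≠ 0) :
    Filter.Tendsto (fun M : ℕ => Real.pi / (M : ℝ) *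
      ∑ k ∈ Finset.range (5 * M / 6), Real.log |auxF a β c (Real.pi / M) ((k + 1 : ℕ) : ℝ)|)
      Filter.atTop (nhds (2 * ∫ t in (0:ℝ)..(5 * Real.pi / 6), auxH t)) := by
  have hp := Real.pi_pos
  have hp4 := Real.pi_lt_d2
  rw [Metric.tendsto_atTop']
  suffices hh : ∀ ε > 0, ∀ᶠ M : ℕ in Filter.atTop, dist (Real.pi / (M : ℝ) *
      ∑ k ∈ Finset.range (5 * M / 6), Real.log |auxF a β c (Real.pi / M) ((k + 1 : ℕ) : ℝ)|)
      (2 * ∫ t in (0:ℝ)..(5 * Real.pi / 6), auxH t) < ε by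
    intro ε hε
    obtain ⟨n, hn⟩ := Filter.eventually_atTop.1 (hh ε hε)
    exact ⟨n, fun m hm => hn m hm.le⟩
  intro ε hε
  obtain ⟨η, hη, hη1, hη2⟩ : ∃ η : ℝ, 0 < η ∧ η ≤ 1 / 12 ∧ 180 * η ≤ ε / 4 := by
    refine ⟨min (1 / 12) (ε / 720), by positivity, min_le_left _ _, ?_⟩
    have := min_le_right (1 / 12 : ℝ) (ε / 720)
    linarith
  obtain ⟨K, hK⟩ := exists_nat_ge ((1 + |a| + |β| + |c|) / η)
  rw [div_le_iff₀ hη, mul_comm] at hK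
  have l1 : Filter.Tendsto (fun θ : ℝ => ∑ k ∈ Finset.range K,
      θ * Real.log |auxF a β c θ ((k + 1 : ℕ) : ℝ)|) (nhdsWithin 0 (Set.Ioi 0)) (nhds 0) := by
    have h0 := tendsto_finsetSum (Finset.range K) (x := nhdsWithin (0:ℝ) (Set.Ioi 0))
      (f := fun k θ => θ * Real.log |auxF a β c θ ((k + 1 : ℕ) : ℝ)|) (a := fun _ => 0) ?_
    · simpa using h0
    intro k _
    have hk : (0:ℝ) < ((k + 1 : ℕ) : ℝ) := by positivity
    exact aux_small a β c _ hk.ne' (by positivity) (by positivity) (hc k)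
  have l1' := l1.comp aux_theta
  have l2 : Filter.Tendsto (fun M : ℕ => ∫ t in (0:ℝ)..(K * (Real.pi / M)), auxH t) Filter.atTop
      (nhds 0) := by
    have h1 : Filter.Tendsto (fun M : ℕ => (K:ℝ) * (Real.pi / M)) Filter.atTop (nhds 0) := by
      simpa using (tendsto_const_div_atTop_nhds_zero_nat Real.pi).const_mul (K:ℝ)
    have := (auxH_cont.tendsto 0).comp h1
    rw [intervalIntegral.integral_same] at this
    exact this
  have l3 := (auxH_cont.tendsto _).comp aux_J
  have e1 := (Metric.tendsto_nhds.1 l1') (ε / 8) (by positivity)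
  have e2 := (Metric.tendsto_nhds.1 l2) (ε / 16) (by positivity)
  have e3 := (Metric.tendsto_nhds.1 l3) (ε / 16) (by positivity)
  filter_upwards [e1, e2, e3, Filter.eventually_ge_atTop (2 * K + 1)] with M e1 e2 e3 hM
  have hKJ : K ≤ 5 * M / 6 := by omega
  have hM' : (0:ℝ) < M := by
    have : 0 < M := by omega
    exact_mod_cast this
  have hθ : 0 < Real.pi / M := by positivity
  have hb := aux_block a β c hη hη1 hθ hK hKJ (aux_J_le M)
  have hJ := aux_J_le M
  rw [← intervalIntegral.integral_interval_sub_left (auxH_int 0 _) (auxH_int 0 _)] at hb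
  rw [Finset.range_eq_Ico, ← Finset.sum_Ico_consecutive _ (Nat.zero_le K) hKJ, mul_add,
    ← Finset.range_eq_Ico, Finset.mul_sum]
  simp only [Function.comp, Real.dist_eq, sub_zero] at e1 e2 e3 ⊢
  have hb2 : 60 * η * (((5 * M / 6 : ℕ) : ℝ) * (Real.pi / M)) ≤ 60 * η * 3 := by
    gcongr
    linarith
  have hb3 := hb.trans hb2
  rw [abs_lt] at *
  rw [abs_le] at hb3
  constructor <;> linarith [e1.1, e1.2, e2.1, e2.2, e3.1, e3.2, hb3.1, hb3.2]
noncomputable def auxG (u : ℕ → ℝ) (j : ℕ) : ℝ := ∏ k ∈ Finset.Icc 1 j, u k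

theorem auxG_succ (u : ℕ → ℝ) (j : ℕ) : auxG u (j + 1) = auxG u j * u (j + 1) :=
  Finset.prod_Icc_succ_top (by omega) _

theorem auxG_up (u : ℕ → ℝ) {q : ℝ} (hq : 1 ≤ q) {i j : ℕ} (hij : i ≤ j)
    (h : ∀ k, i < k → k ≤ j → |u k| ≤ q) : |auxG u j| ≤ q ^ (j - i) * |auxG u i| := by
  induction j, hij using Nat.le_induction with
  | base => simp
  | succ j hj ih =>
    have ih' := ih fun k h1 h2 => h k h1 (by omega)
    rw [auxG_succ, abs_mul, Nat.succ_sub hj, pow_succ]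
    calc _ ≤ (q ^ (j - i) * |auxG u i|) * q := by
          gcongr
          exact h _ (by omega) le_rfl
      _ = _ := by ring

theorem auxG_down (u : ℕ → ℝ) {q : ℝ} (hq : 1 ≤ q) {i j : ℕ} (hij : i ≤ j)
    (h : ∀ k, i < k → k ≤ j → 1 ≤ q * |u k|) : |auxG u i| ≤ q ^ (j - i) * |auxG u j| := by
  induction j, hij using Nat.le_induction with
  | base => simp
  | succ j hj ih =>
    have ih' := ih fun k h1 h2 => h k h1 (by omega)
    rw [auxG_succ, abs_mul, Nat.succ_sub hj, pow_succ]
    calc _ ≤ (q ^ (j - i) * |auxG u j|) * 1 := by rw [mul_one]; exact ih'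
      _ ≤ (q ^ (j - i) * |auxG u j|) * (q * |u (j + 1)|) := by
          gcongr
          exact h _ (by omega) le_rfl
      _ = _ := by ring

theorem auxG_sign (u : ℕ → ℝ) {i j : ℕ} (hij : i ≤ j)
    (h : ∀ k, i < k → k ≤ j → 0 < u k) : 0 ≤ auxG u i * auxG u j := by
  induction j, hij using Nat.le_induction with
  | base => exact mul_self_nonneg _
  | succ j hj ih =>
    have ih' := ih fun k h1 h2 => h k h1 (by omega)
    rw [auxG_succ, ← mul_assoc]
    exact mul_nonneg ih' (h _ (by omega) le_rfl).le

theorem aux_comb (u : ℕ → ℝ) {q A τ : ℝ} {I J K N : ℕ} (hq : 1 ≤ q) (hqA : q ^ N ≤ A)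
    (hKI : K ≤ I) (hIJ : I ≤ J) (hJN : J + K + 1 ≤ N) (hJ1 : 1 ≤ J)
    (h1 : ∀ k, 1 ≤ k → k ≤ I → |u k| ≤ q)
    (h2 : ∀ k, I < k → k ≤ J → 1 ≤ q * |u k|)
    (h3 : ∀ k, J < k → k < N → |u k| ≤ q)
    (h4 : ∀ k, K ≤ k → 1 ≤ k → k + K ≤ N → 0 < u k)
    (h5 : ∀ k, N < k + K → k < N → |u k| ≤ τ) (hτ : 0 ≤ τ)
    (h6 : K * A * τ ≤ 1 / 4) (h7 : 1 + K * A ≤ |auxG u J| / 4) :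
    |auxG u J| / 2 ≤ |1 + ∑ j ∈ Finset.Icc 1 (N - 1), auxG u j| ∧
    |1 + ∑ j ∈ Finset.Icc 1 (N - 1), auxG u j| ≤ (1 + N * A) * |auxG u J| := by
  have hA : 1 ≤ A := (one_le_pow₀ hq).trans hqA
  have hpw : ∀ m, m ≤ N → q ^ m ≤ A := fun m hm => (pow_le_pow_right₀ hq hm).trans hqA
  have hKA : 0 ≤ K * A := by positivity
  have hG1 : 1 ≤ |auxG u J| := by linarith
  have b1 : ∀ j, j ≤ I → |auxG u j| ≤ A := by
    intro j hj
    have := auxG_up u hq (Nat.zero_le j) (fun k hk hk2 => h1 k hk (by omega))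
    have e : auxG u 0 = 1 := by simp [auxG]
    rw [e, abs_one, mul_one] at this
    exact this.trans (hpw _ (by omega))
  have b2 : ∀ j, I ≤ j → j ≤ J → |auxG u j| ≤ A * |auxG u J| := by
    intro j hj hj2
    refine (auxG_down u hq hj2 (fun k hk hk2 => h2 k (by omega) hk2)).trans ?_
    gcongr
    exact hpw _ (by omega)
  have b3 : ∀ j, J ≤ j → j < N → |auxG u j| ≤ A * |auxG u J| := by
    intro j hj hj2
    refine (auxG_up u hq hj (fun k hk hk2 => h3 k (by omega) (by omega))).trans ?_
    gcongr
    exact hpw _ (by omega)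
  have b4 : ∀ j, j < N → |auxG u j| ≤ A * |auxG u J| := by
    intro j hj
    rcases le_total j I with h | h
    · exact (b1 j h).trans (by nlinarith)
    · rcases le_total j J with h' | h'
      · exact b2 j h h'
      · exact b3 j h' hj
  constructor
  · obtain ⟨σ, hσ, hσG⟩ : ∃ σ : ℝ, |σ| = 1 ∧ σ * auxG u J = |auxG u J| := by
      rcases abs_choice (auxG u J) with h | h
      · exact ⟨1, by simp, by rw [h, one_mul]⟩
      · exact ⟨-1, by simp, by rw [h]; ring⟩
    have hσ2 : σ * σ = 1 := by rw [← abs_mul_abs_self, hσ]; norm_num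
    have hab : ∀ x : ℝ, -|x| ≤ σ * x := by
      intro x
      have := neg_abs_le (σ * x)
      rwa [abs_mul, hσ, one_mul] at this
    have low : ∀ j ∈ Finset.Icc 1 (N - 1), (if j = J then |auxG u J| else 0)
        - (if j < K then A else 0) - (if N < j + K then A * |auxG u J| * τ else 0)
        ≤ σ * auxG u j := by
      intro j hj
      rw [Finset.mem_Icc] at hj
      have hx : 0 ≤ A * |auxG u J| * τ := by positivity
      by_cases c1 : j = J
      · subst c1
        rw [hσG]
        split_ifs <;> linarith
      · rw [if_neg c1]
        by_cases c2 : j < K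
        · have := hab (auxG u j)
          have := b1 j (by omega)
          split_ifs
          linarith
          linarith
        · by_cases c3 : N < j + K
          · have t1 := hab (auxG u j)
            have t2 := b3 (j - 1) (by omega) (by omega)
            have t3 := h5 j c3 (by omega)
            have t4 := auxG_succ u (j - 1)
            rw [Nat.sub_add_cancel hj.1] at t4
            have t5 : |auxG u j| ≤ A * |auxG u J| * τ := by
              rw [t4, abs_mul]
              gcongr
            rw [if_neg c2, if_pos c3]
            linarith
          · rw [if_neg c2, if_neg c3]
            have t : 0 ≤ auxG u j * auxG u J := by
              rcases le_total j J with h | h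
              · exact auxG_sign u h (fun k _ _ => h4 k (by omega) (by omega) (by omega))
              · rw [mul_comm]
                exact auxG_sign u h (fun k _ _ => h4 k (by omega) (by omega) (by omega))
            have t2 : auxG u j * auxG u J = (σ * auxG u j) * |auxG u J| := by
              rw [← hσG]; linear_combination (- auxG u j * auxG u J) * hσ2
            rw [t2] at t
            have := nonneg_of_mul_nonneg_left t (by linarith)
            linarith
    have hs := Finset.sum_le_sum low
    rw [Finset.sum_sub_distrib, Finset.sum_sub_distrib, Finset.sum_ite_eq',
      if_pos (Finset.mem_Icc.2 ⟨hJ1, by omega⟩), ← Finset.sum_filter, ← Finset.sum_filter,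
      Finset.sum_const, Finset.sum_const, nsmul_eq_mul, nsmul_eq_mul, ← Finset.mul_sum] at hs
    have c1 : (((Finset.Icc 1 (N - 1)).filter (fun j => j < K)).card : ℝ) ≤ K := by
      have : ((Finset.Icc 1 (N - 1)).filter (fun j => j < K)).card ≤ (Finset.range K).card := by
        apply Finset.card_le_card
        intro j hj
        rw [Finset.mem_filter] at hj
        exact Finset.mem_range.2 hj.2
      rw [Finset.card_range] at this
      exact_mod_cast this
    have c2 : (((Finset.Icc 1 (N - 1)).filter (fun j => N < j + K)).card : ℝ) ≤ K := by
      have : ((Finset.Icc 1 (N - 1)).filter (fun j => N < j + K)).card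
          ≤ (Finset.Ico (N - K) N).card := by
        apply Finset.card_le_card
        intro j hj
        rw [Finset.mem_filter, Finset.mem_Icc] at hj
        rw [Finset.mem_Ico]
        omega
      rw [Nat.card_Ico] at this
      have h' : N - (N - K) ≤ K := by omega
      exact_mod_cast this.trans h'
    have d1 := mul_le_mul_of_nonneg_right c1 (by linarith : 0 ≤ A)
    have d2 := mul_le_mul_of_nonneg_right c2 (by positivity : 0 ≤ A * |auxG u J| * τ)
    have d3 : (K:ℝ) * (A * |auxG u J| * τ) ≤ 1 / 4 * |auxG u J| := by
      calc _ = (K * A * τ) * |auxG u J| := by ring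
        _ ≤ _ := by gcongr
    have d4 := hab 1
    rw [abs_one] at d4
    have d5 : σ * (1 + ∑ j ∈ Finset.Icc 1 (N - 1), auxG u j)
      ≤ |1 + ∑ j ∈ Finset.Icc 1 (N - 1), auxG u j| := by
      have := le_abs_self (σ * (1 + ∑ j ∈ Finset.Icc 1 (N - 1), auxG u j))
      rwa [abs_mul, hσ, one_mul] at this
    linarith
  · refine (abs_add_le _ _).trans ?_
    rw [abs_one]
    have e : ∑ j ∈ Finset.Icc 1 (N - 1), |auxG u j| ≤ N * (A * |auxG u J|) := by
      refine (Finset.sum_le_card_nsmul _ _ (A * |auxG u J|) (fun j hj => b4 j ?_)).trans ?_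
      · rw [Finset.mem_Icc] at hj; omega
      · rw [Nat.card_Icc, nsmul_eq_mul]
        gcongr
        omega
    have := (Finset.abs_sum_le_sum_abs (auxG u) (Finset.Icc 1 (N - 1))).trans e
    linarith
set_option maxHeartbeats 4000000 in
theorem aux_main (a c : ℝ) (B : ℕ) (ha : 0 ≤ a) (hc : ∀ k : ℕ, (k + 1 : ℕ) - c ≠ 0) :
    Filter.Tendsto (fun N : ℕ => 2 * Real.pi / (N : ℝ) * Real.log |1 + ∑ j ∈ Finset.Icc 1 (N - 1),
      auxG (fun k : ℕ => auxF a B c (Real.pi / ((N + B : ℕ) : ℝ)) k) j|) Filter.atTop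
      (nhds (4 * ∫ t in (0:ℝ)..(5 * Real.pi / 6), auxH t)) := by
  have hp := Real.pi_pos
  have hL := auxH_pos
  set L := ∫ t in (0:ℝ)..(5 * Real.pi / 6), auxH t with hLd
  obtain ⟨K, hK⟩ := exists_nat_ge (a + |c| + B + 1)
  obtain ⟨C, hC, hCb⟩ := aux_unif a B c
  obtain ⟨u, hu⟩ : ∃ u : ℕ → ℕ → ℝ,
      u = fun (N k : ℕ) => auxF a B c (Real.pi / ((N + B : ℕ) : ℝ)) k := ⟨_, rfl⟩
  obtain ⟨G, hG⟩ : ∃ G : ℕ → ℝ, G = fun N => auxG (u N) (5 * (N + B) / 6) := ⟨_, rfl⟩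
  obtain ⟨θ, hθd⟩ : ∃ θ : ℕ → ℝ, θ = fun N => Real.pi / ((N + B : ℕ) : ℝ) := ⟨_, rfl⟩
  have hKc : c ≤ K - 1 ∧ -c ≤ K - 1 ∧ a + B + 1 ≤ K := by
    have h1 := le_abs_self c
    have h2 := neg_abs_le c
    have h3 : (0:ℝ) ≤ B := by positivity
    refine ⟨?_, ?_, ?_⟩ <;> linarith
  obtain ⟨hK1, hK2, hK3⟩ := hKc
  have hthN : ∀ N : ℕ, 1 ≤ N → 0 < θ N ∧ θ N * (N + B) = Real.pi := by
    intro N hN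
    have : (0:ℝ) < ((N + B : ℕ) : ℝ) := by
      have : 0 < N + B := by omega
      exact_mod_cast this
    rw [hθd]
    refine ⟨by positivity, ?_⟩
    push_cast at this ⊢
    field_simp
  -- signs
  have hbasic : ∀ N k : ℕ, K + 1 ≤ N → 1 ≤ k → k + K ≤ N →
      0 < Real.sin (k * θ N + a * θ N) ∧ 0 < Real.sin (k * θ N) ∧
      0 < Real.sin (k * θ N + B * θ N) ∧ -Real.pi < k * θ N - c * θ N ∧
      k * θ N - c * θ N < Real.pi := by
    intro N k hN hk hkN
    obtain ⟨ht, hpi⟩ := hthN N (by omega)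
    have hk' : (1:ℝ) ≤ k := by exact_mod_cast hk
    have hkN' : (k:ℝ) + K ≤ N := by exact_mod_cast hkN
    have hB : (0:ℝ) ≤ B := by positivity
    refine ⟨?_, ?_, ?_, ?_, ?_⟩
    · apply Real.sin_pos_of_pos_of_lt_pi
      · positivity
      · rw [← hpi]; nlinarith
    · apply Real.sin_pos_of_pos_of_lt_pi
      · positivity
      · rw [← hpi]; nlinarith
    · apply Real.sin_pos_of_pos_of_lt_pi
      · positivity
      · rw [← hpi]; nlinarith
    · rw [← hpi]; nlinarith
    · rw [← hpi]; nlinarith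
  have hne : ∀ N k : ℕ, K + 1 ≤ N → 1 ≤ k → k + K ≤ N → u N k ≠ 0 := by
    intro N k hN hk hkN
    obtain ⟨h1, h2, h3, h4, h5⟩ := hbasic N k hN hk hkN
    obtain ⟨ht, hpi⟩ := hthN N (by omega)
    have h6 : Real.sin (k * θ N - c * θ N) ≠ 0 := by
      intro h
      rw [Real.sin_eq_zero_iff_of_lt_of_lt h4 h5, ← sub_mul] at h
      have := hc (k - 1)
      rw [Nat.sub_add_cancel hk] at this
      exact (mul_ne_zero this ht.ne') h
    rw [hθd] at h1 h2 h3 h6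
    rw [hu]
    simp only [auxF]
    exact mul_ne_zero (mul_ne_zero (mul_ne_zero (by norm_num) (div_ne_zero h1.ne' h2.ne')) h3.ne') h6
  have hposs : ∀ N k : ℕ, K + 1 ≤ N → K ≤ k → 1 ≤ k → k + K ≤ N → 0 < u N k := by
    intro N k hN hKk hk hkN
    obtain ⟨h1, h2, h3, h4, h5⟩ := hbasic N k hN hk hkN
    obtain ⟨ht, hpi⟩ := hthN N (by omega)
    have hKk' : (K:ℝ) ≤ k := by exact_mod_cast hKk
    have h6 : 0 < Real.sin (k * θ N - c * θ N) := by
      apply Real.sin_pos_of_pos_of_lt_pi _ h5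
      nlinarith
    rw [hθd] at h1 h2 h3 h6
    rw [hu]
    simp only [auxF]
    positivity
  -- uniform estimate
  have hunif : ∀ N k : ℕ, 1 ≤ k → k < N →
      |u N k - 4 * Real.sin (k * θ N) ^ 2| ≤ C * θ N := by
    intro N k hk hkN
    obtain ⟨ht, hpi⟩ := hthN N (by omega)
    have hk' : (1:ℝ) ≤ k := by exact_mod_cast hk
    have hkN' : (k:ℝ) + 1 ≤ N := by exact_mod_cast hkN
    have hB : (0:ℝ) ≤ B := by positivity
    have := hCb (θ N) (k * θ N) ht (by nlinarith) (by rw [← hpi]; nlinarith)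
    rw [hθd] at this ⊢
    rw [hu]
    exact this
  -- first limit
  have lim1 : Filter.Tendsto (fun N => θ N * Real.log |G N|) Filter.atTop (nhds (2 * L)) := by
    have := (aux_limit a B c ha (by positivity) hc).comp (Filter.tendsto_add_atTop_nat B)
    refine this.congr' ?_
    filter_upwards [Filter.eventually_ge_atTop (6 * K + 5 * B + 6)] with N hN
    simp only [Function.comp, hθd, hG, auxG]
    congr 1
    rw [Finset.abs_prod, Real.log_prod, ← Finset.Ico_succ_right_eq_Icc, Finset.sum_Ico_eq_sum_range]
    · simp only [hu, Nat.succ_eq_add_one, Nat.add_sub_cancel, Order.succ_eq_add_one, add_comm 1]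
    · intro k hk
      rw [Finset.mem_Icc] at hk
      exact abs_ne_zero.2 (hne N k (by omega) hk.1 (by omega))
  have limθ : Filter.Tendsto θ Filter.atTop (nhds 0) := by
    have := (tendsto_const_div_atTop_nhds_zero_nat Real.pi).comp (Filter.tendsto_add_atTop_nat B)
    rw [hθd]
    exact this
  have limlog : Filter.Tendsto (fun N => Real.log |G N|) Filter.atTop Filter.atTop := by
    have h1 : Filter.Tendsto (fun N : ℕ => ((N:ℝ) + B) / Real.pi) Filter.atTop Filter.atTop :=
      (Filter.tendsto_atTop_add_const_right _ _ tendsto_natCast_atTop_atTop).atTop_div_const hp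
    have := lim1.pos_mul_atTop (by positivity) h1
    refine this.congr' ?_
    filter_upwards [Filter.eventually_ge_atTop 1] with N hN
    obtain ⟨ht, hpi⟩ := hthN N hN
    rw [← hpi]
    have : (0:ℝ) < N + B := by
      have : 0 < N + B := by omega
      exact_mod_cast this
    field_simp
  have hGbig : ∀ R : ℝ, ∀ᶠ N in Filter.atTop, R ≤ |G N| := by
    intro R
    have h1 := (Real.tendsto_exp_atTop.comp limlog).eventually_ge_atTop R
    filter_upwards [h1, limlog.eventually_ge_atTop 1] with N h1 h2
    have : G N ≠ 0 := by
      intro h0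
      rw [h0] at h2
      simp at h2
      linarith
    simp only [Function.comp] at h1
    rwa [Real.exp_log (abs_pos.2 this)] at h1
  -- sandwich
  set A := Real.exp (2 * C * Real.pi) with hA
  have hA1 : 1 ≤ A := Real.one_le_exp (by positivity)
  set D := 4 * ((K:ℝ) + B) + C with hD
  have hD0 : 0 < D := by positivity
  have hsand : ∀ᶠ N in Filter.atTop,
      |G N| / 2 ≤ |1 + ∑ j ∈ Finset.Icc 1 (N - 1), auxG (u N) j| ∧
      |1 + ∑ j ∈ Finset.Icc 1 (N - 1), auxG (u N) j| ≤ (1 + N * A) * |G N| := by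
    have ev1 : ∀ᶠ N in Filter.atTop, C * θ N ≤ 1 / 2 := by
      have := limθ.const_mul C
      rw [mul_zero] at this
      exact this.eventually_le_const (by norm_num)
    have ev2 : ∀ᶠ N in Filter.atTop, K * A * (D * θ N) ≤ 1 / 4 := by
      have := (limθ.const_mul D).const_mul (K * A)
      rw [mul_zero, mul_zero] at this
      exact this.eventually_le_const (by norm_num)
    filter_upwards [ev1, ev2, hGbig (4 * (1 + K * A)),
      Filter.eventually_ge_atTop (6 * K + 5 * B + 12)] with N e1 e2 e3 hN
    obtain ⟨ht, hpi⟩ := hthN N (by omega)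
    have hB : (0:ℝ) ≤ B := by positivity
    have hCt : 0 < C * θ N := by positivity
    have hqq : 1 + 2 * (C * θ N) ≤ Real.exp (2 * C * θ N) := by
      have := Real.add_one_le_exp (2 * C * θ N)
      linarith
    have hG' : G N = auxG (u N) (5 * (N + B) / 6) := by rw [hG]
    rw [hG'] at e3 ⊢
    have hsmall : ∀ k : ℕ, 1 ≤ k → k < N → Real.sin (k * θ N) ≤ 1 / 2 →
        |u N k| ≤ Real.exp (2 * C * θ N) := by
      intro k hk hkN hs
      have h1 := hunif N k hk hkN
      have hk' : (1:ℝ) ≤ k := by exact_mod_cast hk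
      have hkN' : (k:ℝ) + 1 ≤ N := by exact_mod_cast hkN
      have hs0 : 0 ≤ Real.sin (k * θ N) := by
        apply Real.sin_nonneg_of_nonneg_of_le_pi (by positivity)
        rw [← hpi]; nlinarith
      have hs2 : 4 * Real.sin (k * θ N) ^ 2 ≤ 1 := by nlinarith
      have hs3 : 0 ≤ 4 * Real.sin (k * θ N) ^ 2 := by positivity
      rw [abs_le] at h1 ⊢
      constructor <;> linarith [h1.1, h1.2]
    apply aux_comb (u N) (q := Real.exp (2 * C * θ N)) (A := A) (τ := D * θ N)
      (I := (N + B) / 6) (K := K)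
    · exact Real.one_le_exp (by positivity)
    · rw [← Real.exp_nat_mul, hA]
      apply Real.exp_le_exp.2
      rw [← hpi]
      have : 0 ≤ C * θ N * B := by positivity
      nlinarith
    · omega
    · omega
    · omega
    · omega
    · intro k hk hkI
      apply hsmall k hk (by omega)
      have h6 : 6 * k ≤ N + B := by omega
      have h6' : 6 * (k:ℝ) ≤ N + B := by exact_mod_cast h6
      have hk0 : 0 ≤ k * θ N := by positivity
      have hkp : k * θ N ≤ Real.pi / 6 := by rw [← hpi]; nlinarith
      rw [← Real.sin_pi_div_six]
      apply Real.sin_le_sin_of_le_of_le_pi_div_two <;> linarith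
    · intro k hk hkJ
      have h6 : N + B ≤ 6 * k := by omega
      have h6' : (N:ℝ) + B ≤ 6 * (k:ℝ) := by exact_mod_cast h6
      have h7 : 6 * k ≤ 5 * (N + B) := by omega
      have h7' : 6 * (k:ℝ) ≤ 5 * (N + B) := by exact_mod_cast h7
      have hkp : Real.pi / 6 ≤ k * θ N := by rw [← hpi]; nlinarith
      have hkp2 : k * θ N ≤ 5 * Real.pi / 6 := by rw [← hpi]; nlinarith
      have hs : 1 / 2 ≤ Real.sin (k * θ N) := by
        rcases le_total (k * θ N) (Real.pi / 2) with h | h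
        · rw [← Real.sin_pi_div_six]
          apply Real.sin_le_sin_of_le_of_le_pi_div_two <;> linarith
        · rw [← Real.sin_pi_div_six, ← Real.sin_pi_sub (k * θ N)]
          apply Real.sin_le_sin_of_le_of_le_pi_div_two <;> linarith
      have h1 := (abs_le.1 (hunif N k (by omega) (by omega))).1
      have h2 := le_abs_self (u N k)
      have h3 : 1 - C * θ N ≤ |u N k| := by nlinarith
      calc (1:ℝ) ≤ (1 + 2 * (C * θ N)) * (1 - C * θ N) := by nlinarith
        _ ≤ _ := by
          apply mul_le_mul hqq h3 (by linarith) (Real.exp_pos _).le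
    · intro k hk hkN
      apply hsmall k (by omega) hkN
      have h6 : 5 * (N + B) ≤ 6 * k := by omega
      have h6' : 5 * ((N:ℝ) + B) ≤ 6 * (k:ℝ) := by exact_mod_cast h6
      have hkN' : (k:ℝ) + 1 ≤ N := by exact_mod_cast hkN
      have hkp : 5 * Real.pi / 6 ≤ k * θ N := by rw [← hpi]; nlinarith
      have hkp2 : k * θ N ≤ Real.pi := by rw [← hpi]; nlinarith
      rw [← Real.sin_pi_div_six, ← Real.sin_pi_sub (k * θ N)]
      apply Real.sin_le_sin_of_le_of_le_pi_div_two <;> linarith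
    · intro k h1 h2 h3
      exact hposs N k (by omega) h1 h2 h3
    · intro k hk hkN
      have hkN' : (k:ℝ) + 1 ≤ N := by exact_mod_cast hkN
      have hk' : (N:ℝ) ≤ k + K := by exact_mod_cast hk.le
      have h1 := abs_le.1 (hunif N k (by omega) hkN)
      have hs0 : 0 ≤ Real.sin (k * θ N) := by
        apply Real.sin_nonneg_of_nonneg_of_le_pi (by positivity)
        rw [← hpi]; nlinarith
      have hs1 : Real.sin (k * θ N) ≤ (K + B) * θ N := by
        rw [← Real.sin_pi_sub]
        refine (Real.sin_le ?_).trans ?_ <;> rw [← hpi] <;> nlinarith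
      have hs2 : Real.sin (k * θ N) ^ 2 ≤ (K + B) * θ N := by
        have := Real.sin_le_one (k * θ N)
        nlinarith
      have hs3 : 0 ≤ Real.sin (k * θ N) ^ 2 := by positivity
      rw [hD, abs_le]
      constructor <;> nlinarith [h1.1, h1.2]
    · positivity
    · exact e2
    · linarith
  -- conclusion
  have hdiff : Filter.Tendsto (fun N : ℕ => 2 * Real.pi / (N : ℝ) *
      (Real.log |1 + ∑ j ∈ Finset.Icc 1 (N - 1), auxG (u N) j| - Real.log |G N|))
      Filter.atTop (nhds 0) := by
    have hlogN : Filter.Tendsto (fun N : ℕ => Real.log N / N) Filter.atTop (nhds 0) :=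
      (Real.isLittleO_log_id_atTop.tendsto_div_nhds_zero).comp tendsto_natCast_atTop_atTop
    have hb : Filter.Tendsto (fun N : ℕ => (2 * Real.pi * (Real.log 2 + Real.log (1 + A))) / (N:ℝ)
        + 2 * Real.pi * (Real.log N / N)) Filter.atTop (nhds 0) := by
      have := (tendsto_const_div_atTop_nhds_zero_nat
        (2 * Real.pi * (Real.log 2 + Real.log (1 + A)))).add (hlogN.const_mul (2 * Real.pi))
      simpa using this
    refine squeeze_zero_norm' ?_ hb
    filter_upwards [hsand, hGbig 1, Filter.eventually_ge_atTop 1] with N hs hg hN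
    have hN' : (1:ℝ) ≤ N := by exact_mod_cast hN
    have hG0 : 0 < |G N| := by linarith
    obtain ⟨s1, s2⟩ := hs
    have hP0 : 0 < |1 + ∑ j ∈ Finset.Icc 1 (N - 1), auxG (u N) j| := by linarith
    have t1 := Real.log_le_log (by positivity) s1
    rw [Real.log_div hG0.ne' (by norm_num)] at t1
    have t2 := Real.log_le_log hP0 s2
    rw [Real.log_mul (by positivity) hG0.ne'] at t2
    have t3 : Real.log (1 + N * A) ≤ Real.log N + Real.log (1 + A) := by
      rw [← Real.log_mul (by positivity) (by positivity)]
      apply Real.log_le_log (by positivity)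
      nlinarith
    have t4 : 0 ≤ Real.log N := Real.log_nonneg hN'
    have t5 : 0 ≤ Real.log (1 + A) := Real.log_nonneg (by linarith)
    have t6 : 0 ≤ Real.log 2 := Real.log_nonneg (by norm_num)
    rw [norm_mul, Real.norm_eq_abs, Real.norm_eq_abs, abs_of_pos (by positivity)]
    calc _ ≤ 2 * Real.pi / (N:ℝ) * (Real.log 2 + Real.log (1 + A) + Real.log N) := by
          gcongr
          rw [abs_le]
          constructor <;> linarith
      _ = _ := by ring
  have hmain : Filter.Tendsto (fun N : ℕ => 2 * Real.pi / (N : ℝ) * Real.log |G N|)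
      Filter.atTop (nhds (4 * L)) := by
    have h1 : Filter.Tendsto (fun N : ℕ => 2 * (1 + (B:ℝ) / N)) Filter.atTop (nhds 2) := by
      have := ((tendsto_const_div_atTop_nhds_zero_nat (B:ℝ)).const_add 1).const_mul 2
      simpa using this
    have h2 := h1.mul lim1
    rw [show 2 * (2 * L) = 4 * L by ring] at h2
    refine h2.congr' ?_
    filter_upwards [Filter.eventually_ge_atTop 1] with N hN
    obtain ⟨ht, hpi⟩ := hthN N hN
    rw [← hpi]
    have : (0:ℝ) < N := by exact_mod_cast hN
    field_simp
  have := hmain.add hdiff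
  rw [add_zero] at this
  refine this.congr fun N => ?_
  rw [hu]
  ring

theorem volume_conjecture_figure_eight_real (n b : ℤ) (hn : 2 ≤ n) (hb : 1 ≤ b)
    (h : ¬ ∃ m : ℤ, 0 < m ∧ n - 1 - b = 2 * m) :
    Filter.Tendsto
      (fun N : ℕ => 2 * Real.pi / (N : ℝ) * Real.log |P n b N|)
      Filter.atTop
      (nhds (4 * ∫ t in (0:ℝ)..(5 * Real.pi / 6), Real.log (2 * Real.sin t))) := by
  obtain ⟨B, hB⟩ := Int.eq_ofNat_of_zero_le (show 0 ≤ b - 1 by omega)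
  have hb' : b = B + 1 := by omega
  subst hb'
  have hn' : (2:ℝ) ≤ n := by exact_mod_cast hn
  rw [auxH_eq]
  have hB0 : (0:ℝ) ≤ B := by positivity
  have key := aux_main (((n:ℝ) - 2 + B) / 2) (((n:ℝ) - 2 - B) / 2) B (by linarith) (by
    intro k hk
    apply h
    refine ⟨k + 1, by omega, ?_⟩
    have : (n:ℝ) - 1 - (B + 1) = 2 * (k + 1) := by push_cast at hk; linarith
    exact_mod_cast this)
  refine key.congr fun N => ?_
  have e : ∀ k : ℕ, auxF (((n:ℝ) - 2 + B) / 2) B (((n:ℝ) - 2 - B) / 2)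
      (Real.pi / ((N + B : ℕ) : ℝ)) k = f n (B + 1) N k := by
    intro k
    unfold auxF f
    push_cast
    rw [show (B:ℝ) + 1 - 1 = B by ring]
    congr 1
    · congr 1
      · congr 3
        · ring
        · ring
      · congr 1; ring
    · congr 1; ring
  simp only [P, g, auxG, e]
end

section
/- Fix integers n ≥ 2, b ≥ 1 and set b̃ = b−1. For an integer N ≥ 2, let ζ = exp(πi/(N+b̃)) ∈ ℂ, a = ζ^n, t = ζ^{−(N+n−2)}. Then the complex number 1 + ∑_{k=1}^{N−1} ∏_{i=1}^{k} [(ζ^{N−i} − ζ^{−(N−i)})/(ζ^{i} − ζ^{−i})] · (a ζ^{i−2} + t^{−1} a^{−1} ζ^{−(i−2)}) · (t^{2} a ζ^{N−2+i} + t^{−1} a^{−1} ζ^{−(N−2+i)}) equals the real number 1 + ∑_{j=1}^{N−1} ∏_{k=1}^{j} f(N,k), where f(N,k) = 4 · (sin((((n−2+b̃)/2)+k)·π/(N+b̃)) / sin(k·π/(N+b̃))) · sin((k+b̃)·π/(N+b̃)) · sin((k−(n−2−b̃)/2)·π/(N+b̃)). In particular, the complex expression is real. -/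
open Filter Finset

lemma aux_sum (p q x e : ℂ) (hx : x = (p - q) / 2 + Real.pi / 2) (he : e = (p + q) / 2) :
    Complex.exp (p * Complex.I) + Complex.exp (q * Complex.I)
      = Complex.exp (e * Complex.I) * (2 * Complex.sin x) := by
  subst hx he
  rw [Complex.sin_add_pi_div_two, Complex.two_cos, mul_add, ← Complex.exp_add, ← Complex.exp_add]
  congr 2 <;> ring

lemma aux_diff (p : ℂ) :
    Complex.exp (p * Complex.I) - Complex.exp (-p * Complex.I)
      = (2 * Complex.I) * Complex.sin p := by
  rw [Complex.sin]
  linear_combination (Complex.exp (p * Complex.I) - Complex.exp (-p * Complex.I)) * Complex.I_sq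

theorem superpolynomial_real_form (n b : ℤ) (hn : 2 ≤ n) (hb : 1 ≤ b)
    (N : ℕ) (hN : 2 ≤ N) :
    (let ζ : ℂ := Complex.exp (Real.pi * Complex.I / ((N : ℂ) + (b : ℂ) - 1))
     let a : ℂ := ζ ^ n
     let t : ℂ := ζ ^ (-((N : ℤ) + n - 2))
     1 + ∑ k ∈ Finset.Icc 1 (N - 1), ∏ i ∈ Finset.Icc 1 k,
        ((ζ ^ ((N : ℤ) - (i : ℤ)) - ζ ^ (-((N : ℤ) - (i : ℤ)))) /
            (ζ ^ (i : ℤ) - ζ ^ (-(i : ℤ)))) *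
          (a * ζ ^ ((i : ℤ) - 2) + t⁻¹ * a⁻¹ * ζ ^ (-((i : ℤ) - 2))) *
          (t ^ 2 * a * ζ ^ ((N : ℤ) - 2 + (i : ℤ)) +
            t⁻¹ * a⁻¹ * ζ ^ (-((N : ℤ) - 2 + (i : ℤ)))))
      = ((1 + ∑ j ∈ Finset.Icc 1 (N - 1), ∏ k ∈ Finset.Icc 1 j, f n b N k : ℝ) : ℂ) := by
  have hM : (N : ℂ) + (b : ℂ) - 1 ≠ 0 := by
    have h : (N : ℤ) + b - 1 ≠ 0 := by omega
    exact_mod_cast h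
  have hM2 : (N : ℂ) + ((b : ℂ) - 1) ≠ 0 := by rwa [← add_sub_assoc]
  extract_lets ζ a t
  have hz0 : ζ ≠ 0 := Complex.exp_ne_zero _
  obtain ⟨θ, hθ⟩ : ∃ θ : ℂ, θ = Real.pi / ((N : ℂ) + (b : ℂ) - 1) := ⟨_, rfl⟩
  have hπ : (Real.pi : ℂ) = ((N : ℂ) + (b : ℂ) - 1) * θ := by rw [hθ]; field_simp
  have hz : ∀ m : ℤ, ζ ^ m = Complex.exp ((m * θ) * Complex.I) := by
    intro m
    simp only [ζ]
    rw [← Complex.exp_int_mul, hθ]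
    congr 1
    ring
  push_cast
  congr 1
  refine Finset.sum_congr rfl fun k _ => Finset.prod_congr rfl fun i _ => ?_
  have e1 : a * ζ ^ ((i : ℤ) - 2) = ζ ^ (n + i - 2) := by
    simp only [a]; rw [← zpow_add₀ hz0]; congr 1; ring
  have e2 : t⁻¹ * a⁻¹ * ζ ^ (-((i : ℤ) - 2)) = ζ ^ ((N : ℤ) - i) := by
    simp only [a, t]
    rw [← zpow_neg, ← zpow_neg, ← zpow_add₀ hz0, ← zpow_add₀ hz0]; congr 1; ring
  have e3 : t ^ 2 * a * ζ ^ ((N : ℤ) - 2 + (i : ℤ)) = ζ ^ (-(N : ℤ) - n + 2 + i) := by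
    simp only [a, t]
    rw [pow_two, ← zpow_add₀ hz0, ← zpow_add₀ hz0, ← zpow_add₀ hz0]; congr 1; ring
  have e4 : t⁻¹ * a⁻¹ * ζ ^ (-((N : ℤ) - 2 + (i : ℤ))) = ζ ^ (-(i : ℤ)) := by
    simp only [a, t]
    rw [← zpow_neg, ← zpow_neg, ← zpow_add₀ hz0, ← zpow_add₀ hz0]; congr 1; ring
  rw [e1, e2, e3, e4]
  have hd : ∀ m : ℤ, ζ ^ m - ζ ^ (-m) = (2 * Complex.I) * Complex.sin (m * θ) := by
    intro m
    rw [← aux_diff, hz, hz]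
    push_cast
    ring_nf
  rw [hd, hd, hz (n + i - 2), hz ((N : ℤ) - i), hz (-(N : ℤ) - n + 2 + i), hz (-(i : ℤ))]
  have hI : (2 * Complex.I) ≠ 0 := by simp
  rw [mul_div_mul_left _ _ hI]
  rw [aux_sum _ _ ((((n : ℂ) - 2 + (b - 1)) / 2 + i) * θ) (((N : ℂ) + n - 2) / 2 * θ)
      (by rw [hπ]; push_cast; ring) (by push_cast; ring),
    aux_sum _ _ (((i : ℂ) - ((n : ℂ) - 2 - (b - 1)) / 2) * θ) (-(((N : ℂ) + n - 2) / 2 * θ))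
      (by rw [hπ]; push_cast; ring) (by push_cast; ring)]
  have hs : Complex.sin (((N : ℤ) - (i : ℤ) : ℤ) * θ) = Complex.sin (((i : ℂ) + (b - 1)) * θ) := by
    rw [← Complex.sin_pi_sub, hπ]
    congr 1
    push_cast
    ring
  have hE : Complex.exp (((N : ℂ) + n - 2) / 2 * θ * Complex.I) *
      Complex.exp (-(((N : ℂ) + n - 2) / 2 * θ) * Complex.I) = 1 := by
    rw [← Complex.exp_add, neg_mul, add_neg_cancel, Complex.exp_zero]
  rw [hs, f]
  push_cast
  have hq : ∀ x : ℂ, x * Real.pi / ((N : ℂ) + ((b : ℂ) - 1)) = x * θ := by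
    intro x; rw [hθ, ← add_sub_assoc, mul_div_assoc]
  simp only [hq]
  generalize Complex.exp (((N : ℂ) + n - 2) / 2 * θ * Complex.I) = E at *
  generalize Complex.exp (-(((N : ℂ) + n - 2) / 2 * θ) * Complex.I) = E' at *
  simp only [div_eq_mul_inv] at *
  linear_combination (4 * Complex.sin (((i : ℂ) + (b - 1)) * θ) * (Complex.sin ((i : ℂ) * θ))⁻¹ *
    Complex.sin ((((n : ℂ) - 2 + (b - 1)) * 2⁻¹ + i) * θ) *
    Complex.sin (((i : ℂ) - ((n : ℂ) - 2 - (b - 1)) * 2⁻¹) * θ)) * hE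
end

section
/- Fix integers n ≥ 2 and b ≥ 1 such that (n−1−b)/2 is not a positive integer, and set b̃ = b−1. There exists N₀ such that for every integer N ≥ N₀ and every integer k with (5/6)(N+b̃) + (n−2−b̃)/2 < k ≤ N−1, one has f(N,k) < 1, where f(N,k) = 4 · (sin((((n−2+b̃)/2)+k)·π/(N+b̃)) / sin(k·π/(N+b̃))) · sin((k+b̃)·π/(N+b̃)) · sin((k−(n−2−b̃)/2)·π/(N+b̃)). -/
open Finset

lemma key_aux (A B C D : ℝ) (hA : -(Real.pi / 6) ≤ A) (hAC : A ≤ C) (hC0 : 0 < C)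
    (hC : C < Real.pi / 6) (hB : 0 < B) (hBD : B ≤ D) (hD : D ≤ Real.pi / 2) :
    4 * (Real.sin A / Real.sin D) * Real.sin B * Real.sin C < 1 := by
  have hpi := Real.pi_pos
  have sC : Real.sin C < 1 / 2 := by
    rw [← Real.sin_pi_div_six]
    exact Real.sin_lt_sin_of_lt_of_le_pi_div_two (by linarith) (by linarith) hC
  have sC0 : 0 < Real.sin C := Real.sin_pos_of_pos_of_lt_pi hC0 (by linarith)
  have sAC : Real.sin A ≤ Real.sin C :=
    Real.sin_le_sin_of_le_of_le_pi_div_two (by linarith) (by linarith) hAC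
  have sBD : Real.sin B ≤ Real.sin D :=
    Real.sin_le_sin_of_le_of_le_pi_div_two (by linarith) (by linarith) hBD
  have sB : 0 < Real.sin B := Real.sin_pos_of_pos_of_lt_pi hB (by linarith)
  have sD : 0 < Real.sin D := by linarith
  have e : 4 * (Real.sin A / Real.sin D) * Real.sin B * Real.sin C
      = 4 * (Real.sin A * Real.sin C) * (Real.sin B / Real.sin D) := by ring
  have r1 : Real.sin B / Real.sin D ≤ 1 := (div_le_one sD).2 sBD
  have r0 : 0 < Real.sin B / Real.sin D := div_pos sB sD
  have p : 4 * (Real.sin A * Real.sin C) < 1 := by nlinarith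
  rw [e]
  nlinarith

theorem f_lt_one_of_large (n b : ℤ) (hn : 2 ≤ n) (hb : 1 ≤ b)
    (h : ¬ ∃ m : ℤ, 0 < m ∧ n - 1 - b = 2 * m) :
    ∃ N₀ : ℕ, ∀ N : ℕ, N₀ ≤ N → ∀ k : ℕ,
      (5 : ℝ) / 6 * ((N : ℝ) + ((b : ℝ) - 1)) + ((n : ℝ) - 2 - ((b : ℝ) - 1)) / 2
          < (k : ℝ) →
      k ≤ N - 1 → f n b N k < 1 := by
  refine ⟨b.toNat, fun N hN k hk hkN => ?_⟩
  have hbN : b ≤ (N : ℤ) := by omega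
  have hN1 : k + 1 ≤ N := by omega
  have hnR : (2 : ℝ) ≤ n := by exact_mod_cast hn
  have hbR : (1 : ℝ) ≤ b := by exact_mod_cast hb
  have hbNR : (b : ℝ) ≤ N := by exact_mod_cast hbN
  have hkR : (k : ℝ) + 1 ≤ N := by exact_mod_cast hN1
  have hpi := Real.pi_pos
  unfold f
  set β : ℝ := (b : ℝ) - 1 with hβ
  set M : ℝ := (N : ℝ) + β with hM
  have hM0 : 0 < M := by linarith
  have flip : ∀ x : ℝ, Real.sin (x * Real.pi / M) = Real.sin ((M - x) * Real.pi / M) := by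
    intro x
    rw [← Real.sin_pi_sub]
    congr 1
    field_simp
  rw [flip, flip k, flip (k + β), flip (k - _)]
  apply key_aux
  · rw [le_div_iff₀ hM0]; nlinarith
  · gcongr; linarith
  · apply div_pos _ hM0
    apply mul_pos _ hpi
    linarith
  · rw [div_lt_iff₀ hM0]; nlinarith
  · apply div_pos _ hM0
    apply mul_pos _ hpi
    linarith
  · gcongr; linarith
  · rw [div_le_iff₀ hM0]; nlinarith
end

section
/- Fix integers n ≥ 2 and b ≥ 1 such that (n−1−b)/2 is not a positive integer, and set b̃ = b−1. There exists N₀ such that for every integer N ≥ N₀ and every integer k with (1/2)(N+b̃) ≤ k < (5/6)(N+b̃) − (3(n−2)+7b̃)/4, one has f(N,k) > 1, where f(N,k) = 4 · (sin((((n−2+b̃)/2)+k)·π/(N+b̃)) / sin(k·π/(N+b̃))) · sin((k+b̃)·π/(N+b̃)) · sin((k−(n−2−b̃)/2)·π/(N+b̃)). -/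
open Finset

theorem key_aux_s7 (x a c t : ℝ) (ha : 0 ≤ a) (hc : 0 ≤ c) (hx : Real.pi / 2 ≤ x)
    (ht : t = 3 / 4 * (a + c)) (hy : x + c < 5 * Real.pi / 6 - t) :
    1 < 4 * (Real.sin (x + (a + c) / 2) / Real.sin x) * Real.sin (x + c)
      * Real.sin (x - (a - c) / 2) := by
  have hpi := Real.pi_pos
  have ht0 : 0 ≤ t := by rw [ht]; positivity
  have hsx : 0 < Real.sin x := Real.sin_pos_of_pos_of_lt_pi (by linarith) (by linarith)
  have hsy : 0 < Real.sin (x + c) := Real.sin_pos_of_pos_of_lt_pi (by linarith) (by linarith)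
  have hyx : Real.sin (x + c) ≤ Real.sin x := by
    rw [← Real.sin_pi_sub (x + c), ← Real.sin_pi_sub x]
    exact Real.sin_le_sin_of_le_of_le_pi_div_two (by linarith) (by linarith) (by linarith)
  have hlow : Real.sin (Real.pi / 6 + t) < Real.sin (x + c) := by
    rw [← Real.sin_pi_sub (x + c)]
    exact Real.sin_lt_sin_of_lt_of_le_pi_div_two (by linarith) (by linarith) (by linarith)
  have hlow0 : 0 < Real.sin (Real.pi / 6 + t) :=
    Real.sin_pos_of_pos_of_lt_pi (by linarith) (by linarith)
  have hst : Real.sin (a / 2) ≤ Real.sin t :=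
    Real.sin_le_sin_of_le_of_le_pi_div_two (by linarith) (by linarith) (by linarith)
  have hsa : 0 ≤ Real.sin (a / 2) := Real.sin_nonneg_of_nonneg_of_le_pi (by linarith) (by linarith)
  have hcos : 0 ≤ Real.cos (Real.pi / 6 + t) :=
    Real.cos_nonneg_of_neg_pi_div_two_le_of_le (by linarith) (by linarith)
  have h3 : Real.sqrt 3 ^ 2 = 3 := Real.sq_sqrt (by norm_num)
  have e1 : Real.sin (Real.pi / 6 + t) ^ 2
      = 1 / 4 + Real.sin t * (Real.sin t + Real.cos (Real.pi / 6 + t)) := by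
    rw [Real.sin_add, Real.cos_add, Real.sin_pi_div_six, Real.cos_pi_div_six]
    linear_combination (1 / 4 * Real.sin t ^ 2) * h3 + 1 / 4 * Real.sin_sq_add_cos_sq t
  have e2 : Real.sin (x + (a + c) / 2) * Real.sin (x - (a - c) / 2)
      = Real.sin x * Real.sin (x + c) + Real.sin (c / 2) ^ 2 - Real.sin (a / 2) ^ 2 := by
    have s1 : x + (a + c) / 2 = (x + c / 2) + a / 2 := by ring
    have s2 : x - (a - c) / 2 = (x + c / 2) - a / 2 := by ring
    have s3 : Real.sin x = Real.sin ((x + c / 2) - c / 2) := by congr 1; ring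
    have s4 : x + c = (x + c / 2) + c / 2 := by ring
    rw [s1, s2, s3, s4]
    generalize x + c / 2 = u
    simp only [Real.sin_add, Real.sin_sub]
    have p1 := Real.sin_sq_add_cos_sq u
    have p2 := Real.sin_sq_add_cos_sq (a / 2)
    have p3 := Real.sin_sq_add_cos_sq (c / 2)
    linear_combination Real.sin u ^ 2 * p2 - Real.sin u ^ 2 * p3
      - Real.sin (a / 2) ^ 2 * p1 + Real.sin (c / 2) ^ 2 * p1
  have e3 : 4 * (Real.sin (x + (a + c) / 2) / Real.sin x) * Real.sin (x + c)
      * Real.sin (x - (a - c) / 2)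
      = 4 * Real.sin (x + c) * (Real.sin (x + (a + c) / 2) * Real.sin (x - (a - c) / 2))
        / Real.sin x := by ring
  rw [e3, e2, lt_div_iff₀ hsx, one_mul]
  have m1 : Real.sin (a / 2) ^ 2 ≤ Real.sin t ^ 2 := pow_le_pow_left₀ hsa hst 2
  have m2 : 0 ≤ Real.sin t * Real.cos (Real.pi / 6 + t) := mul_nonneg (hsa.trans hst) hcos
  have m3 : Real.sin (Real.pi / 6 + t) ^ 2 < Real.sin (x + c) ^ 2 :=
    pow_lt_pow_left₀ hlow hlow0.le (by norm_num)
  have m4 : 1 / 4 + Real.sin (a / 2) ^ 2 < Real.sin (x + c) ^ 2 := by nlinarith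
  have m5 := mul_lt_mul_of_pos_left m4 hsx
  have m6 := mul_le_mul_of_nonneg_right hyx (sq_nonneg (Real.sin (a / 2)))
  have m7 := mul_nonneg hsy.le (sq_nonneg (Real.sin (c / 2)))
  nlinarith

theorem f_gt_one_in_middle_range (n b : ℤ) (hn : 2 ≤ n) (hb : 1 ≤ b)
    (h : ¬ ∃ m : ℤ, 0 < m ∧ n - 1 - b = 2 * m) :
    ∃ N₀ : ℕ, ∀ N : ℕ, N₀ ≤ N → ∀ k : ℕ,
      (1 : ℝ) / 2 * ((N : ℝ) + ((b : ℝ) - 1)) ≤ (k : ℝ) →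
      (k : ℝ) < (5 : ℝ) / 6 * ((N : ℝ) + ((b : ℝ) - 1)) -
          (3 * ((n : ℝ) - 2) + 7 * ((b : ℝ) - 1)) / 4 →
      1 < f n b N k := by
  refine ⟨1, fun N hN k hk1 hk2 => ?_⟩
  have hn' : (2 : ℝ) ≤ n := by exact_mod_cast hn
  have hb' : (1 : ℝ) ≤ b := by exact_mod_cast hb
  have hN' : (1 : ℝ) ≤ N := by exact_mod_cast hN
  have hpi := Real.pi_pos
  unfold f
  obtain ⟨M, hM⟩ : ∃ M : ℝ, M = (N : ℝ) + ((b : ℝ) - 1) := ⟨_, rfl⟩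
  rw [← hM] at hk1 hk2 ⊢
  have hM0 : 0 < M := by linarith
  have hh : 0 < Real.pi / M := by positivity
  have hMh : M * (Real.pi / M) = Real.pi := by field_simp
  have q1 := mul_le_mul_of_nonneg_right hk1 hh.le
  have q2 := mul_lt_mul_of_pos_right hk2 hh
  have key := key_aux_s7 (k * (Real.pi / M)) (((n : ℝ) - 2) * (Real.pi / M))
    (((b : ℝ) - 1) * (Real.pi / M)) _ (mul_nonneg (by linarith) hh.le)
    (mul_nonneg (by linarith) hh.le) (by linarith) rfl (by linarith)
  convert key using 1
  congr 1
  · congr 1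
    · congr 1
      congr 1
      · congr 1
        ring
      · congr 1
        ring
    · congr 1
      ring
  · congr 1
    ring
end

section
/- Fix integers n ≥ 2 and b ≥ 1 such that (n−1−b)/2 is not a positive integer, and set b̃ = b−1. Define f(N,k) = 4 · (sin((((n−2+b̃)/2)+k)·π/(N+b̃)) / sin(k·π/(N+b̃))) · sin((k+b̃)·π/(N+b̃)) · sin((k−(n−2−b̃)/2)·π/(N+b̃)), g(N,j) = ∏_{k=1}^{j} f(N,k), and P(N) = 1 + ∑_{j=1}^{N−1} g(N,j). Then there exists N₀ such that for all integers N ≥ N₀: max_{1 ≤ j ≤ N−1} |g(N,j)| ≤ |P(N)| ≤ N · max_{1 ≤ j ≤ N−1} |g(N,j)|. -/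
open Finset

/-- sine in units of `π / M`. -/
noncomputable def SS (M a : ℝ) : ℝ := Real.sin (a * Real.pi / M)

lemma SS_pos {M a : ℝ} (h0 : 0 < a) (h1 : a < M) : 0 < SS M a := by
  have hM : 0 < M := h0.trans h1
  apply Real.sin_pos_of_pos_of_lt_pi
  · positivity
  · rw [div_lt_iff₀ hM]; nlinarith [Real.pi_pos]

lemma SS_abs_le {M a : ℝ} (hM : 0 < M) : |SS M a| ≤ 4 * |a| / M := by
  have h1 : |SS M a| ≤ |a * Real.pi / M| := Real.abs_sin_le_abs
  refine h1.trans ?_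
  rw [abs_div, abs_mul, abs_of_pos Real.pi_pos, abs_of_pos hM]
  rw [mul_comm 4 |a|]
  gcongr
  exact Real.pi_le_four

lemma SS_abs_le_one {M a : ℝ} : |SS M a| ≤ 1 := Real.abs_sin_le_one _

lemma SS_neg {M a : ℝ} : SS M (-a) = - SS M a := by
  unfold SS; rw [← Real.sin_neg]; congr 1; ring

lemma SS_low {M a : ℝ} (hM : 0 < M) (h0 : 0 ≤ a) (h1 : 2 * a ≤ M) : 2 * a / M ≤ SS M a := by
  have := Real.mul_le_sin (x := a * Real.pi / M) (by have := Real.pi_pos; positivity)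
    (by rw [div_le_div_iff₀ hM two_pos]; nlinarith [Real.pi_pos])
  unfold SS
  refine le_trans (le_of_eq ?_) this
  have := Real.pi_pos.ne'
  field_simp

lemma SS_mono {M a c : ℝ} (hM : 0 < M) (h0 : 0 ≤ a) (h1 : a ≤ c) (h2 : a + c ≤ M) :
    SS M a ≤ SS M c := by
  unfold SS
  have h := Real.sin_sub_sin (c * Real.pi / M) (a * Real.pi / M)
  have hp := Real.pi_pos
  have e1 : 0 ≤ Real.sin ((c * Real.pi / M - a * Real.pi / M) / 2) := by
    have : (c * Real.pi / M - a * Real.pi / M) / 2 = (c - a) * Real.pi / (2 * M) := by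
      field_simp
    rw [this]
    apply Real.sin_nonneg_of_nonneg_of_le_pi
    · have : 0 ≤ c - a := by linarith
      positivity
    · rw [div_le_iff₀ (by positivity)]; nlinarith
  have e2 : 0 ≤ Real.cos ((c * Real.pi / M + a * Real.pi / M) / 2) := by
    have : (c * Real.pi / M + a * Real.pi / M) / 2 = (c + a) * Real.pi / (2 * M) := by
      field_simp
    rw [this]
    have h3 : 0 ≤ (c + a) * Real.pi / (2 * M) := by
      have : 0 ≤ c + a := by linarith
      positivity
    apply Real.cos_nonneg_of_neg_pi_div_two_le_of_le
    · linarith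
    · rw [div_le_div_iff₀ (by positivity) two_pos]; nlinarith
  nlinarith [mul_nonneg e1 e2]

lemma SS_refl {M a : ℝ} (hM : 0 < M) : SS M (M - a) = SS M a := by
  unfold SS
  rw [← Real.sin_pi_sub]; congr 1; field_simp; ring

lemma SS_mid {M a : ℝ} (hM : 0 < M) (h1 : M ≤ 3 * a) (h2 : 3 * a ≤ 2 * M) :
    (0.8 : ℝ) ≤ SS M a := by
  refine le_trans ?_ (SS_mono (a := M / 3) hM (by positivity) (by linarith) (by linarith))
  unfold SS
  have : M / 3 * Real.pi / M = Real.pi / 3 := by field_simp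
  rw [this, Real.sin_pi_div_three]
  have : (1.6 : ℝ) ≤ √3 := Real.le_sqrt_of_sq_le (by norm_num)
  linarith

noncomputable def QQ (M m : ℕ) : ℝ := ∏ k ∈ Finset.range m, (2 * SS M ((k : ℝ) + 1))

lemma QQ_full (M : ℕ) (hM : 0 < M) : QQ (M + 1) M = M + 1 := by
  have h := (Complex.isPrimitiveRoot_exp (M + 1) (by omega)).prod_one_sub_pow_eq_order
  have h2 := congrArg norm h
  rw [norm_prod] at h2
  unfold QQ
  have h3 : ‖((M : ℂ) + 1)‖ = (M : ℝ) + 1 := by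
    have := Complex.norm_natCast (M + 1)
    push_cast at this; exact this
  rw [h3] at h2
  rw [← h2]
  apply Finset.prod_congr rfl
  intro k hk
  rw [Finset.mem_range] at hk
  have hkM : (k : ℝ) < M := by exact_mod_cast hk
  have hpos : 0 < SS ((M + 1 : ℕ) : ℝ) ((k : ℝ) + 1) := SS_pos (by positivity) (by push_cast; linarith)
  have e : Complex.exp (2 * Real.pi * Complex.I / ((M + 1 : ℕ) : ℂ)) ^ (k + 1)
      = Complex.exp (Complex.I * ((2 * (((k : ℝ) + 1) * Real.pi / ((M + 1 : ℕ) : ℝ)) : ℝ) : ℂ)) := by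
    rw [← Complex.exp_nat_mul]
    congr 1
    push_cast
    field_simp
  rw [norm_sub_rev, e, Complex.norm_exp_I_mul_ofReal_sub_one]
  unfold SS at hpos ⊢
  rw [mul_div_cancel_left₀ _ (two_ne_zero), Real.norm_eq_abs, abs_of_pos (by positivity)]

lemma QQ_pos (M m : ℕ) (h : m < M) : 0 < QQ M m := by
  unfold QQ
  apply Finset.prod_pos
  intro k hk
  rw [Finset.mem_range] at hk
  have : ((k : ℝ) + 1) < M := by exact_mod_cast (by omega : k + 1 < M)
  have := SS_pos (M := (M : ℝ)) (a := (k : ℝ) + 1) (by positivity) this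
  positivity

lemma QQ_add_le (M m r : ℕ) (h : m + r < M) : QQ M (m + r) ≤ QQ M m * 2 ^ r := by
  unfold QQ
  rw [Finset.prod_range_add]
  have h0 := QQ_pos M m (by omega)
  unfold QQ at h0
  apply mul_le_mul_of_nonneg_left _ h0.le
  calc _ ≤ ∏ k ∈ Finset.range r, (2 : ℝ) := by
        apply Finset.prod_le_prod
        · intro k hk
          rw [Finset.mem_range] at hk
          have : (((m + k : ℕ) : ℝ) + 1) < M := by exact_mod_cast (by omega : m + k + 1 < M)
          have := SS_pos (M := (M : ℝ)) (a := ((m + k : ℕ) : ℝ) + 1) (by positivity) this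
          positivity
        · intro k hk
          have := le_of_abs_le (SS_abs_le_one (M := (M : ℝ)) (a := ((m + k : ℕ) : ℝ) + 1))
          linarith
    _ = 2 ^ r := by simp

lemma QQ_lower (M m E : ℕ) (h0 : 2 ≤ M) (h : 2 * m < M) (h2 : M ≤ 2 * m + 1 + 2 * E) :
    1 ≤ QQ M m * 2 ^ E := by
  have hp := QQ_pos M m (by omega)
  obtain ⟨r, hr⟩ : ∃ r, M = 2 * m + r + 1 := ⟨M - 2 * m - 1, by omega⟩
  have hfull : QQ M (m + (m + r)) = M := by
    have := QQ_full (M - 1) (by omega)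
    have e : M - 1 + 1 = M := by omega
    rw [e] at this
    have e2 : m + (m + r) = M - 1 := by omega
    rw [e2, this]
    exact_mod_cast e
  have hsplit : QQ M (m + (m + r)) = QQ M m * QQ M (m + r) := by
    unfold QQ
    rw [Finset.prod_range_add]
    congr 1
    rw [← Finset.prod_range_reflect]
    apply Finset.prod_congr rfl
    intro k hk
    rw [Finset.mem_range] at hk
    congr 1
    rw [← SS_refl (by positivity)]
    congr 1
    have : (((m + (m + r - 1 - k) : ℕ) : ℝ) + 1) + (k + 1) = M := by
      exact_mod_cast (by omega : (m + (m + r - 1 - k) + 1) + (k + 1) = M)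
    linarith
  have h3 := QQ_add_le M m r (by omega)
  have h4 : (1 : ℝ) ≤ M := by exact_mod_cast (by omega : 1 ≤ M)
  have h5 : (2 : ℝ) ^ r ≤ 2 ^ (E + E) := pow_le_pow_right₀ (by norm_num) (by omega)
  have h6 : 1 ≤ (QQ M m * 2 ^ E) ^ 2 := by
    calc (1 : ℝ) ≤ QQ M m * QQ M (m + r) := by rw [← hsplit, hfull]; exact h4
      _ ≤ QQ M m * (QQ M m * 2 ^ (E + E)) := by gcongr; exact h3.trans (by gcongr)
      _ = _ := by rw [pow_add]; ring
  exact (one_le_sq_iff₀ (by positivity)).1 h6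

lemma comb (F : ℕ → ℝ) (D N : ℕ) (C : ℝ) (hC : 1 ≤ C)
    (h1 : ∀ k, 1 ≤ k → k ≤ N - 1 → |F k| ≤ C)
    (h2 : ∀ k, 1 ≤ k → k ≤ D + 1 → |F k| ≤ 1)
    (h3 : ∀ k, 1 ≤ k → N ≤ k + D → k ≤ N - 1 → |F k| ≤ 1 / (2 * C * (D + 1)))
    (hpos : ∀ k, D < k → k + D < N → 0 < F k)
    (hbig : ∃ j ∈ Finset.Icc 1 (N - 1), 2 * C * (D + 1) ≤ |∏ k ∈ Finset.Icc 1 j, F k|)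
    (hne : (Finset.Icc 1 (N - 1)).Nonempty) :
    (Finset.Icc 1 (N - 1)).sup' hne (fun j => |∏ k ∈ Finset.Icc 1 j, F k|) ≤
      |1 + ∑ j ∈ Finset.Icc 1 (N - 1), ∏ k ∈ Finset.Icc 1 j, F k| ∧
    |1 + ∑ j ∈ Finset.Icc 1 (N - 1), ∏ k ∈ Finset.Icc 1 j, F k| ≤
      N * (Finset.Icc 1 (N - 1)).sup' hne (fun j => |∏ k ∈ Finset.Icc 1 j, F k|) := by
  obtain ⟨G, hG⟩ : ∃ G : ℕ → ℝ, G = fun j => ∏ k ∈ Finset.Icc 1 j, F k := ⟨_, rfl⟩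
  have hG' : ∀ j, ∏ k ∈ Finset.Icc 1 j, F k = G j := fun j => by rw [hG]
  simp only [hG'] at hbig ⊢
  have hGs : ∀ j, G (j + 1) = G j * F (j + 1) := fun j => by
    rw [hG]; exact Finset.prod_Icc_succ_top (by omega) _
  have hG0 : G 0 = 1 := by rw [hG]; simp
  obtain ⟨js, hjs, hA⟩ := Finset.exists_mem_eq_sup' hne (fun j => |G j|)
  have hmax : ∀ j, 1 ≤ j → j ≤ N - 1 → |G j| ≤ |G js| := fun j a c => by
    rw [← hA]; exact Finset.le_sup' (fun j => |G j|) (Finset.mem_Icc.2 ⟨a, c⟩)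
  rw [hA]
  rw [Finset.mem_Icc] at hjs
  obtain ⟨A, hAdef⟩ : ∃ A, A = |G js| := ⟨_, rfl⟩
  rw [← hAdef] at hmax ⊢
  have hDp : (0 : ℝ) ≤ D := by positivity
  have hAbig : 2 * C * (D + 1) ≤ A := by
    obtain ⟨j, hj, hj2⟩ := hbig
    rw [Finset.mem_Icc] at hj
    exact hj2.trans (hmax j hj.1 hj.2)
  have hA2 : 2 ≤ A := by nlinarith [mul_nonneg (sub_nonneg.2 hC) hDp]
  have hsmall : ∀ j, j ≤ D + 1 → |G j| ≤ 1 := by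
    intro j
    induction j with
    | zero => intro _; rw [hG0]; simp
    | succ j ih =>
      intro hj
      rw [hGs, abs_mul]
      exact mul_le_one₀ (ih (by omega)) (abs_nonneg _) (h2 _ (by omega) hj)
  have hj1 : D + 2 ≤ js := by
    by_contra hc
    have := hsmall js (by omega)
    linarith
  have heps : 1 / (2 * C * (D + 1)) ≤ 1 / 2 := by
    apply one_div_le_one_div_of_le two_pos
    nlinarith [mul_nonneg (sub_nonneg.2 hC) hDp]
  have hend : ∀ j, 2 ≤ j → N ≤ j + D → j ≤ N - 1 → |G j| ≤ A * (1 / (2 * C * (D + 1))) := by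
    intro j a c e
    obtain ⟨i, rfl⟩ : ∃ i, j = i + 1 := ⟨j - 1, by omega⟩
    rw [hGs, abs_mul]
    exact mul_le_mul (hmax i (by omega) (by omega)) (h3 _ (by omega) c e) (abs_nonneg _)
      (by linarith)
  have hj2 : js + D < N := by
    by_contra hc
    have := hend js (by omega) (by omega) (by omega)
    nlinarith
  constructor
  · -- lower bound
    obtain ⟨s, hs, hs1⟩ : ∃ s : ℝ, |s| = 1 ∧ s * G D = |G D| := by
      rcases le_total 0 (G D) with h | h
      · exact ⟨1, by simp, by rw [abs_of_nonneg h]; ring⟩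
      · exact ⟨-1, by simp, by rw [abs_of_nonpos h]; ring⟩
    have hsgn : ∀ j, j + D < N → D ≤ j → s * G j = |G j| := by
      intro j h5 h6
      induction j, h6 using Nat.le_induction with
      | base => exact hs1
      | succ j hj ih =>
        rw [hGs, ← mul_assoc, ih (by omega), abs_mul,
          abs_of_pos (hpos (j + 1) (by omega) (by omega))]
    obtain ⟨i, rfl⟩ : ∃ i, js = i + 1 := ⟨js - 1, by omega⟩
    have hprev : A / C ≤ |G i| := by
      rw [div_le_iff₀ (by linarith), hAdef, hGs, abs_mul]
      exact mul_le_mul_of_nonneg_left (h1 _ (by omega) (by omega)) (abs_nonneg _)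
    have hpt : ∀ j ∈ Finset.Icc 1 (N - 1), (if j = i + 1 then A else 0) + (if j = i then A / C else 0)
        - (if j ∈ Finset.Icc 1 D then 1 else 0)
        - (if j ∈ Finset.Ico (N - D) N then A * (1 / (2 * C * (D + 1))) else 0) ≤ s * G j := by
      intro j hj
      rw [Finset.mem_Icc] at hj
      have habs : |s * G j| = |G j| := by rw [abs_mul, hs, one_mul]
      have hlow := neg_abs_le (s * G j)
      rw [habs] at hlow
      simp only [Finset.mem_Icc, Finset.mem_Ico]
      by_cases c1 : j = i + 1
      · subst c1
        rw [hsgn _ (by omega) (by omega), ← hAdef, if_pos rfl, if_neg (by omega), if_neg (by omega),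
          if_neg (by omega)]
        linarith
      by_cases c2 : j = i
      · subst c2
        rw [hsgn _ (by omega) (by omega), if_pos rfl, if_neg (by omega), if_neg (by omega),
          if_neg (by omega)]
        linarith
      by_cases c3 : j ≤ D
      · rw [if_neg c1, if_neg c2, if_pos (by omega), if_neg (by omega)]
        have := hsmall j (by omega)
        linarith
      by_cases c4 : N ≤ j + D
      · rw [if_neg c1, if_neg c2, if_neg (by omega), if_pos (by omega)]
        have := hend j (by omega) c4 hj.2
        linarith
      · rw [if_neg c1, if_neg c2, if_neg (by omega), if_neg (by omega),
          hsgn _ (by omega) (by omega)]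
        have := abs_nonneg (G j)
        linarith
    have hsum := Finset.sum_le_sum hpt
    rw [Finset.sum_sub_distrib, Finset.sum_sub_distrib, Finset.sum_add_distrib,
      Finset.sum_ite_eq', Finset.sum_ite_eq', if_pos (Finset.mem_Icc.2 (by omega)),
      if_pos (Finset.mem_Icc.2 (by omega)), Finset.sum_ite_mem, Finset.sum_ite_mem,
      Finset.inter_eq_right.2 (by intro x; simp only [Finset.mem_Icc]; omega),
      Finset.inter_eq_right.2 (by intro x; simp only [Finset.mem_Icc, Finset.mem_Ico]; omega),
      Finset.sum_const, Finset.sum_const, Nat.card_Icc, Nat.card_Ico, ← Finset.mul_sum] at hsum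
    have e1 : N - (N - D) = D := by omega
    rw [e1] at hsum
    simp only [Nat.add_sub_cancel, nsmul_eq_mul, mul_one] at hsum
    have hfin : s * (1 + ∑ j ∈ Finset.Icc 1 (N - 1), G j) ≤ |1 + ∑ j ∈ Finset.Icc 1 (N - 1), G j| := by
      refine (le_abs_self _).trans ?_
      rw [abs_mul, hs, one_mul]
    have hs2 : -1 ≤ s := by have := neg_abs_le s; linarith
    have e2 : (D : ℝ) * (A * (1 / (2 * C * (D + 1)))) ≤ A / (2 * C) := by
      have : (D : ℝ) * (A * (1 / (2 * C * (D + 1)))) = A / (2 * C) * (D / (D + 1)) := by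
        field_simp
      rw [this]
      apply mul_le_of_le_one_right (by positivity)
      rw [div_le_one (by positivity)]; linarith
    have e3 : (D : ℝ) + 1 ≤ A / (2 * C) := by
      rw [le_div_iff₀ (by positivity)]; linarith
    have e4 : A / C = A / (2 * C) + A / (2 * C) := by field_simp; ring
    linarith
  · calc |1 + ∑ j ∈ Finset.Icc 1 (N - 1), G j|
        ≤ |1| + |∑ j ∈ Finset.Icc 1 (N - 1), G j| := abs_add_le _ _
      _ ≤ 1 + ∑ j ∈ Finset.Icc 1 (N - 1), |G j| := by
          rw [abs_one]; gcongr; exact Finset.abs_sum_le_sum_abs _ _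
      _ ≤ 1 + ∑ j ∈ Finset.Icc 1 (N - 1), A := by
          gcongr with j hj
          rw [Finset.mem_Icc] at hj
          exact hmax j hj.1 hj.2
      _ = 1 + ((N : ℝ) - 1) * A := by
          rw [Finset.sum_const, Nat.card_Icc, nsmul_eq_mul]
          have : ((N - 1 + 1 - 1 : ℕ) : ℝ) = N - 1 := by
            rw [Nat.add_sub_cancel, Nat.cast_sub (by omega)]; simp
          rw [this]
      _ ≤ N * A := by nlinarith

noncomputable def FF (c B d M : ℝ) (k : ℕ) : ℝ :=
  4 * (SS M (c + k) / SS M k) * SS M (k + B) * SS M (k - d)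

lemma FF_abs (c B d E : ℝ) (M k : ℕ) (hc : 0 ≤ c) (hcE : c ≤ E) (hk : 1 ≤ k) (hkM : k < M) :
    |FF c B d M k| ≤ 4 * (1 + 2 * E) * |SS M (k + B)| := by
  have hk' : (1 : ℝ) ≤ k := by exact_mod_cast hk
  have hkM' : (k : ℝ) + 1 ≤ M := by exact_mod_cast hkM
  have hM : (0 : ℝ) < M := by linarith
  have hs : 0 < SS M k := SS_pos (by linarith) (by linarith)
  have h1 : SS M 1 ≤ SS M k := SS_mono hM (by norm_num) hk' (by linarith)
  have h2 : 2 * 1 / (M : ℝ) ≤ SS M 1 := SS_low hM (by norm_num) (by linarith)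
  have h3 : |SS M c| ≤ 2 * E * SS M k := by
    refine (SS_abs_le hM).trans ?_
    rw [abs_of_nonneg hc]
    calc 4 * c / M = 2 * c * (2 * 1 / M) := by ring
      _ ≤ 2 * E * SS M k := by
        apply mul_le_mul (by linarith) (h2.trans h1) (by positivity) (by linarith)
  have h4 : |SS M (c + k)| ≤ (1 + 2 * E) * SS M k := by
    have : SS M (c + k) = SS M c * Real.cos (k * Real.pi / M)
        + Real.cos (c * Real.pi / M) * SS M k := by
      unfold SS; rw [← Real.sin_add]; congr 1; ring
    rw [this]
    refine (abs_add_le _ _).trans ?_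
    rw [abs_mul, abs_mul, abs_of_pos hs]
    have a1 := Real.abs_cos_le_one (k * Real.pi / M)
    have a2 := Real.abs_cos_le_one (c * Real.pi / M)
    have b1 := mul_le_of_le_one_right (abs_nonneg (SS M c)) a1
    have b2 := mul_le_of_le_one_left hs.le a2
    linarith
  unfold FF
  rw [abs_mul, abs_mul, abs_mul, abs_div, abs_of_pos hs, abs_of_pos (by norm_num : (0:ℝ) < 4)]
  have h5 : |SS M (c + k)| / SS M k ≤ 1 + 2 * E := by rwa [div_le_iff₀ hs]
  refine (mul_le_of_le_one_right (by positivity) SS_abs_le_one).trans ?_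
  gcongr

lemma FF_low (c B d : ℝ) (M k : ℕ) (hc : 0 ≤ c) (hB : 0 ≤ B) (hk : 1 ≤ k)
    (h1 : 2 * k + c ≤ M) (h2 : 2 * k + B ≤ M) :
    (2 * SS M k) * (2 * |SS M (k - d)|) ≤ |FF c B d M k| := by
  have hk' : (1 : ℝ) ≤ k := by exact_mod_cast hk
  have hM : (0 : ℝ) < M := by linarith
  have hs : 0 < SS M k := SS_pos (by linarith) (by linarith)
  have a1 : SS M k ≤ SS M (c + k) := SS_mono hM (by linarith) (by linarith) (by linarith)
  have a2 : SS M k ≤ SS M (k + B) := SS_mono hM (by linarith) (by linarith) (by linarith)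
  have a3 : 1 ≤ SS M (c + k) / SS M k := by rwa [one_le_div hs]
  have a4 : 0 < SS M (c + k) := hs.trans_le a1
  have a5 : 0 < SS M (k + B) := hs.trans_le a2
  unfold FF
  rw [abs_mul _ (SS M (k - d)), abs_of_pos (by positivity : 0 < 4 * (SS M (c + k) / SS M k) * SS M (k + B))]
  rw [show 2 * SS M k * (2 * |SS M (k - d)|) = 4 * 1 * SS M k * |SS M (k - d)| by ring]
  gcongr

lemma FF_pos (c B d : ℝ) (M k : ℕ) (hk : 0 < k) (h0 : 0 ≤ c) (hB : 0 ≤ B) (h1 : c + k < M)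
    (h2 : k + B < M) (h3 : d < k) (h4 : k - d < M) : 0 < FF c B d M k := by
  have hk' : (0 : ℝ) < k := by exact_mod_cast hk
  have a1 := SS_pos (M := (M : ℝ)) (a := k) (by linarith) (by linarith)
  have a2 := SS_pos (M := (M : ℝ)) (a := c + k) (by linarith) (by linarith)
  have a3 := SS_pos (M := (M : ℝ)) (a := k + B) (by linarith) (by linarith)
  have a4 := SS_pos (M := (M : ℝ)) (a := k - d) (by linarith) (by linarith)
  unfold FF
  positivity

lemma FF_two (c B d : ℝ) (M k E : ℕ) (hc : |c| ≤ E) (hB : |B| ≤ E) (hd : |d| ≤ E)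
    (h1 : (M : ℝ) ≤ 3 * (k - E)) (h2 : 3 * ((k : ℝ) + E) ≤ 2 * M) (hM : 0 < M) :
    2 ≤ |FF c B d M k| := by
  have hM' : (0 : ℝ) < M := by exact_mod_cast hM
  rw [abs_le] at hc hB hd
  have a2 := SS_mid (M := (M : ℝ)) (a := c + k) hM' (by linarith) (by linarith)
  have a3 := SS_mid (M := (M : ℝ)) (a := k + B) hM' (by linarith) (by linarith)
  have a4 := SS_mid (M := (M : ℝ)) (a := k - d) hM' (by linarith) (by linarith)
  have hE : (0 : ℝ) ≤ E := by positivity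
  have a1 := SS_mid (M := (M : ℝ)) (a := k) hM' (by linarith) (by linarith)
  have hs : 0 < SS M k := by linarith
  have a5 : SS M k ≤ 1 := le_of_abs_le SS_abs_le_one
  refine le_trans ?_ (le_abs_self _)
  unfold FF
  have a6 : (0.8 : ℝ) ≤ SS M (c + k) / SS M k := by
    rw [le_div_iff₀ hs]; linarith
  calc (2 : ℝ) ≤ 4 * 0.8 * 0.8 * 0.8 := by norm_num
    _ ≤ _ := by gcongr

lemma FF_big (c B d : ℝ) (D E : ℕ) (hc0 : 0 ≤ c) (hB0 : 0 ≤ B) (hc : |c| ≤ E) (hB : |B| ≤ E)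
    (hd : |d| ≤ E) (hD : D + 1 ≤ E) (hdD : d ≤ D + 1) (hsep : ∀ k : ℕ, 1 ≤ k → 1 / 2 ≤ |(k : ℝ) - d|)
    (M : ℕ) (hM : 24 * E + 24 ≤ M) :
    ∃ j, 1 ≤ j ∧ j + E + 1 ≤ M ∧
      2 ^ (M / 12) ≤ |∏ k ∈ Finset.Icc 1 j, FF c B d M k| * (2 ^ (3 * E) * (M : ℝ) ^ E) := by
  obtain ⟨p, hp⟩ : ∃ p, p + (D + 1) + E = M / 2 := ⟨M / 2 - E - (D + 1), by omega⟩
  have hM0 : (0 : ℝ) < M := by exact_mod_cast (by omega : 0 < M)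
  have hM1 : (1 : ℝ) ≤ M := by exact_mod_cast (by omega : 1 ≤ M)
  have hMr : (24 : ℝ) * E + 24 ≤ M := by exact_mod_cast hM
  have hE0 : (0 : ℝ) ≤ E := by positivity
  have hDE : (D : ℝ) + 1 ≤ E := by exact_mod_cast hD
  have hc' := abs_le.1 hc
  have hB' := abs_le.1 hB
  have hd' := abs_le.1 hd
  refine ⟨(D + 1) + p + M / 12, by omega, by omega, ?_⟩
  have conv : ∀ j, |∏ k ∈ Finset.Icc 1 j, FF c B d M k| =
      ∏ k ∈ Finset.range j, |FF c B d M (k + 1)| := by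
    intro j
    rw [Finset.abs_prod]
    induction j with
    | zero => simp
    | succ j ih => rw [Finset.prod_Icc_succ_top (by omega), Finset.prod_range_succ, ih]
  rw [conv, Finset.prod_range_add]
  have P2 : (2 : ℝ) ^ (M / 12) ≤
      ∏ x ∈ Finset.range (M / 12), |FF c B d M (D + 1 + p + x + 1)| := by
    calc (2 : ℝ) ^ (M / 12) = ∏ x ∈ Finset.range (M / 12), (2 : ℝ) := by simp
      _ ≤ _ := by
        apply Finset.prod_le_prod
        · intros; norm_num
        · intro x hx
          rw [Finset.mem_range] at hx
          have t1 : (M : ℝ) + 3 * E ≤ 3 * ((D + 1 + p + x + 1 : ℕ) : ℝ) := by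
            exact_mod_cast (by omega : M + 3 * E ≤ 3 * (D + 1 + p + x + 1))
          have t2 : 3 * (((D + 1 + p + x + 1 : ℕ) : ℝ) + E) ≤ 2 * M := by
            exact_mod_cast (by omega : 3 * ((D + 1 + p + x + 1) + E) ≤ 2 * M)
          exact FF_two c B d M _ E hc hB hd (by linarith) t2 (by omega)
  have P1 : QQ M (D + 1 + p) * ((2 / M : ℝ) ^ (D + 1) * QQ M p) ≤
      ∏ k ∈ Finset.range (D + 1 + p), |FF c B d M (k + 1)| := by
    have s1 : ∏ k ∈ Finset.range (D + 1 + p), ((2 * SS M ((k : ℝ) + 1)) *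
        (2 * |SS M (((k + 1 : ℕ) : ℝ) - d)|)) ≤ ∏ k ∈ Finset.range (D + 1 + p), |FF c B d M (k + 1)| := by
      apply Finset.prod_le_prod
      · intro k hk
        rw [Finset.mem_range] at hk
        have : (k : ℝ) + 1 < M := by exact_mod_cast (by omega : k + 1 < M)
        have := SS_pos (M := (M : ℝ)) (a := (k : ℝ) + 1) (by positivity) this
        positivity
      · intro k hk
        rw [Finset.mem_range] at hk
        have t : 2 * ((k + 1 : ℕ) : ℝ) + E ≤ M := by
          exact_mod_cast (by omega : 2 * (k + 1) + E ≤ M)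
        have := FF_low c B d M (k + 1) hc0 hB0 (by omega) (by linarith) (by linarith)
        push_cast at this ⊢
        exact this
    refine le_trans ?_ s1
    rw [Finset.prod_mul_distrib]
    have q0 := QQ_pos M (D + 1 + p) (by omega)
    have q1 := QQ_pos M p (by omega)
    refine mul_le_mul_of_nonneg_left ?_ q0.le
    rw [Finset.prod_range_add]
    apply mul_le_mul _ _ q1.le (Finset.prod_nonneg fun _ _ => by positivity)
    · calc (2 / M : ℝ) ^ (D + 1) = ∏ x ∈ Finset.range (D + 1), (2 / M : ℝ) := by rw [Finset.prod_const, Finset.card_range]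
        _ ≤ _ := by
          apply Finset.prod_le_prod
          · intros; positivity
          · intro k hk
            rw [Finset.mem_range] at hk
            have t : ((k + 1 : ℕ) : ℝ) ≤ E := by exact_mod_cast (by omega : k + 1 ≤ E)
            have t0 : (0 : ℝ) ≤ ((k + 1 : ℕ) : ℝ) := by positivity
            have t1 := hsep (k + 1) (by omega)
            have t2 : |((k + 1 : ℕ) : ℝ) - d| ≤ 2 * E := by rw [abs_le]; constructor <;> linarith
            have t3 : SS M |((k + 1 : ℕ) : ℝ) - d| ≤ |SS M (((k + 1 : ℕ) : ℝ) - d)| := by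
              rcases abs_choice (((k + 1 : ℕ) : ℝ) - d) with h | h
              · rw [h]; exact le_abs_self _
              · rw [h, SS_neg]; exact neg_le_abs _
            have t4 := SS_low hM0 (abs_nonneg (((k + 1 : ℕ) : ℝ) - d)) (by linarith)
            have t5 : 1 / (M : ℝ) ≤ 2 * |((k + 1 : ℕ) : ℝ) - d| / M := by gcongr; linarith
            have : 2 / (M : ℝ) = 2 * (1 / M) := by ring
            rw [this]
            linarith
    · unfold QQ
      apply Finset.prod_le_prod
      · intro k hk
        rw [Finset.mem_range] at hk
        have : (k : ℝ) + 1 < M := by exact_mod_cast (by omega : k + 1 < M)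
        have := SS_pos (M := (M : ℝ)) (a := (k : ℝ) + 1) (by positivity) this
        positivity
      · intro k hk
        rw [Finset.mem_range] at hk
        have t : 2 * ((k : ℝ) + 1) + 2 * E + D + 1 ≤ M + E := by
          exact_mod_cast (by omega : 2 * (k + 1) + 2 * E + D + 1 ≤ M + E)
        have := SS_mono (M := (M : ℝ)) (a := (k : ℝ) + 1) (c := ((D + 1 + k + 1 : ℕ) : ℝ) - d) hM0
          (by positivity) (by push_cast; linarith) (by push_cast; linarith)
        have := le_abs_self (SS M (((D + 1 + k + 1 : ℕ) : ℝ) - d))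
        linarith
  have L1 := QQ_lower M (D + 1 + p) E (by omega) (by omega) (by omega)
  have L2 := QQ_lower M p (2 * E) (by omega) (by omega) (by omega)
  have q0 := QQ_pos M (D + 1 + p) (by omega)
  have q1 := QQ_pos M p (by omega)
  have L3 : 1 ≤ (2 / M : ℝ) ^ (D + 1) * (M : ℝ) ^ E := by
    calc (1 : ℝ) ≤ 2 ^ (D + 1) := one_le_pow₀ (by norm_num)
      _ = (2 / M : ℝ) ^ (D + 1) * (M : ℝ) ^ (D + 1) := by rw [← mul_pow]; congr 1; field_simp
      _ ≤ _ := by gcongr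
  have L4 : 1 ≤ (QQ M (D + 1 + p) * ((2 / M : ℝ) ^ (D + 1) * QQ M p)) * (2 ^ (3 * E) * (M : ℝ) ^ E) := by
    calc (1 : ℝ) ≤ (QQ M (D + 1 + p) * 2 ^ E) * (QQ M p * 2 ^ (2 * E)) *
          ((2 / M : ℝ) ^ (D + 1) * (M : ℝ) ^ E) :=
          one_le_mul_of_one_le_of_one_le (one_le_mul_of_one_le_of_one_le L1 L2) L3
      _ = _ := by rw [show 3 * E = E + 2 * E by ring, pow_add]; ring
  have L5 : 1 ≤ (∏ k ∈ Finset.range (D + 1 + p), |FF c B d M (k + 1)|) * (2 ^ (3 * E) * (M : ℝ) ^ E) :=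
    L4.trans (by gcongr)
  calc (2 : ℝ) ^ (M / 12) = 1 * 2 ^ (M / 12) := by ring
    _ ≤ ((∏ k ∈ Finset.range (D + 1 + p), |FF c B d M (k + 1)|) * (2 ^ (3 * E) * (M : ℝ) ^ E)) *
        ∏ x ∈ Finset.range (M / 12), |FF c B d M (D + 1 + p + x + 1)| := by
          apply mul_le_mul L5 P2 (by positivity) (by positivity)
    _ = _ := by ring

lemma exp_beats (E : ℕ) (K : ℝ) : ∃ M₀ : ℕ, ∀ M : ℕ, M₀ ≤ M →
    K * (2 ^ (3 * E) * (M : ℝ) ^ E) ≤ 2 ^ (M / 12) := by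
  have h := tendsto_pow_const_div_const_pow_of_one_lt E (r := (2 : ℝ)) (by norm_num)
  have h2 : (0 : ℝ) < 1 / (2 * (|K| + 1) * 2 ^ (3 * E) * 12 ^ E) := by positivity
  obtain ⟨n0, hn0⟩ := Filter.eventually_atTop.1 (h.eventually (gt_mem_nhds h2))
  refine ⟨12 * n0, fun M hM => ?_⟩
  have h3 := hn0 (M / 12 + 1) (by omega)
  rw [div_lt_div_iff₀ (by positivity) (by positivity)] at h3
  have h4 : (M : ℝ) ≤ 12 * ((M / 12 + 1 : ℕ) : ℝ) := by
    exact_mod_cast (by omega : M ≤ 12 * (M / 12 + 1))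
  have h5 : (M : ℝ) ^ E ≤ 12 ^ E * ((M / 12 + 1 : ℕ) : ℝ) ^ E := by
    rw [← mul_pow]; gcongr
  rw [pow_succ (2 : ℝ) (M / 12)] at h3
  calc K * (2 ^ (3 * E) * (M : ℝ) ^ E)
      ≤ (|K| + 1) * (2 ^ (3 * E) * (12 ^ E * ((M / 12 + 1 : ℕ) : ℝ) ^ E)) := by
        gcongr
        linarith [le_abs_self K]
    _ ≤ _ := by linarith

theorem superpolynomial_between_max_and_N_max (n b : ℤ) (hn : 2 ≤ n) (hb : 1 ≤ b)
    (h : ¬ ∃ m : ℤ, 0 < m ∧ n - 1 - b = 2 * m) :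
    ∃ N₀ : ℕ, ∀ N : ℕ, N₀ ≤ N → ∀ hne : (Finset.Icc 1 (N - 1)).Nonempty,
      (Finset.Icc 1 (N - 1)).sup' hne (fun j => |g n b N j|) ≤ |P n b N| ∧
      |P n b N| ≤ (N : ℝ) * (Finset.Icc 1 (N - 1)).sup' hne (fun j => |g n b N j|) := by
  obtain ⟨B, hB⟩ : ∃ B : ℕ, b = B + 1 := ⟨(b - 1).toNat, by omega⟩
  obtain ⟨d, hd⟩ : ∃ d : ℝ, d = ((n : ℝ) - 2 - ((b : ℝ) - 1)) / 2 := ⟨_, rfl⟩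
  obtain ⟨c, hc⟩ : ∃ c : ℝ, c = ((n : ℝ) - 2 + ((b : ℝ) - 1)) / 2 := ⟨_, rfl⟩
  have hbr : (b : ℝ) = B + 1 := by rw [hB]; push_cast; ring
  have hnr : (2 : ℝ) ≤ n := by exact_mod_cast hn
  have hB0 : (0 : ℝ) ≤ B := by positivity
  have hcd : c = B + d := by rw [hc, hd, hbr]; ring
  have hc0 : 0 ≤ c := by rw [hc, hbr]; linarith
  have hd0 : -(B : ℝ) ≤ d := by linarith
  have hsep : ∀ k : ℕ, 1 ≤ k → 1 / 2 ≤ |(k : ℝ) - d| := by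
    intro k hk
    have e : (k : ℝ) - d = ((2 * k - (n - 1 - b) : ℤ) : ℝ) / 2 := by
      rw [hd]; push_cast; ring
    have ne : (2 * k - (n - 1 - b) : ℤ) ≠ 0 := fun h0 => h ⟨k, by omega, by omega⟩
    have : (1 : ℝ) ≤ |((2 * k - (n - 1 - b) : ℤ) : ℝ)| := by
      exact_mod_cast Int.one_le_abs ne
    rw [e, abs_div, abs_two]
    linarith
  have hdD : d < (⌊d⌋₊ : ℝ) + 1 := Nat.lt_floor_add_one d
  obtain ⟨D, hD⟩ : ∃ D, D = ⌊d⌋₊ := ⟨_, rfl⟩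
  rw [← hD] at hdD
  obtain ⟨E, hE1, hE2, hE3, hE4⟩ : ∃ E : ℕ, |c| ≤ E ∧ |(B : ℝ)| ≤ E ∧ |d| ≤ E ∧ D + 1 ≤ E := by
    refine ⟨⌈|c|⌉₊ + B + ⌈|d|⌉₊ + (D + 1), ?_, ?_, ?_, by omega⟩
    · have := Nat.le_ceil |c|; push_cast; linarith [Nat.cast_nonneg (α := ℝ) ⌈|d|⌉₊, Nat.cast_nonneg (α := ℝ) D]
    · rw [abs_of_nonneg hB0]; push_cast; linarith [Nat.cast_nonneg (α := ℝ) ⌈|d|⌉₊, Nat.cast_nonneg (α := ℝ) D, Nat.cast_nonneg (α := ℝ) ⌈|c|⌉₊]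
    · have := Nat.le_ceil |d|; push_cast; linarith [Nat.cast_nonneg (α := ℝ) ⌈|c|⌉₊, Nat.cast_nonneg (α := ℝ) D]
  have hE0 : (0 : ℝ) ≤ E := by positivity
  have hD0 : (0 : ℝ) ≤ D := by positivity
  obtain ⟨C, hC⟩ : ∃ C : ℝ, C = 4 * (1 + 2 * (E : ℝ)) := ⟨_, rfl⟩
  have hC1 : 1 ≤ C := by rw [hC]; linarith
  obtain ⟨M0, hM0⟩ := exp_beats E (2 * C * (D + 1))
  obtain ⟨M1, hM1⟩ := exists_nat_ge (C * (8 * E) * (2 * C * (D + 1)))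
  have hBE : B ≤ E := by rw [abs_of_nonneg hB0] at hE2; exact_mod_cast hE2
  refine ⟨M0 + M1 + 24 * E + 24, fun N hN hne => ?_⟩
  obtain ⟨M, hM⟩ : ∃ M, M = N + B := ⟨_, rfl⟩
  have hMr : (M : ℝ) = N + B := by rw [hM]; push_cast; ring
  have hf : ∀ k, f n b N k = FF c B d M k := by
    intro k
    unfold f FF SS
    rw [hMr, ← hc, ← hd, show (b : ℝ) - 1 = B by rw [hbr]; ring]
  have hMpos : (0 : ℝ) < M := by exact_mod_cast (by omega : 0 < M)
  have hep : 1 / (2 * C * (D + 1)) ≤ 1 := by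
    rw [div_le_one (by positivity)]; nlinarith [mul_nonneg (sub_nonneg.2 hC1) hD0]
  have hsm : ∀ k, 1 ≤ k → k < M → |SS M ((k : ℝ) + B)| ≤ 4 * (2 * E) / M →
      |FF c B d M k| ≤ 1 / (2 * C * (D + 1)) := by
    intro k h1 h2 h3
    have := FF_abs c B d E M k hc0 ((le_abs_self c).trans hE1) h1 h2
    rw [← hC] at this
    refine this.trans ?_
    calc C * |SS M ((k : ℝ) + B)| ≤ C * (4 * (2 * E) / M) := by gcongr
      _ ≤ _ := by
        rw [← mul_div_assoc, div_le_div_iff₀ hMpos (by positivity)]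
        have : (M1 : ℝ) ≤ M := by exact_mod_cast (by omega : M1 ≤ M)
        linarith
  have key := comb (fun k => f n b N k) D N C hC1 ?_ ?_ ?_ ?_ ?_ hne
  · exact key
  · intro k h1 h2
    simp only [hf]
    have := FF_abs c B d E M k hc0 ((le_abs_self c).trans hE1) h1 (by omega)
    rw [← hC] at this
    exact this.trans (mul_le_of_le_one_right (by linarith) SS_abs_le_one)
  · intro k h1 h2
    simp only [hf]
    refine (hsm k h1 (by omega) ?_).trans hep
    refine (SS_abs_le hMpos).trans ?_
    rw [abs_of_nonneg (by positivity)]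
    have : (k : ℝ) + B ≤ 2 * E := by exact_mod_cast (by omega : k + B ≤ 2 * E)
    gcongr
  · intro k h1 h2 h3
    simp only [hf]
    refine hsm k h1 (by omega) ?_
    rw [← SS_refl hMpos]
    refine (SS_abs_le hMpos).trans ?_
    have t1 : (k : ℝ) + B ≤ M := by exact_mod_cast (by omega : k + B ≤ M)
    have t2 : (M : ℝ) ≤ 2 * E + (k + B) := by exact_mod_cast (by omega : M ≤ 2 * E + (k + B))
    rw [abs_of_nonneg (by linarith)]
    gcongr
    linarith
  · intro k h1 h2
    simp only [hf]
    have t1 : (D : ℝ) + 1 ≤ k := by exact_mod_cast h1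
    have t2 : (k : ℝ) + D + 1 ≤ N := by exact_mod_cast h2
    exact FF_pos c B d M k (by omega) hc0 hB0 (by linarith) (by linarith) (by linarith) (by linarith)
  · obtain ⟨j, hj1, hj2, hj3⟩ := FF_big c B d D E hc0 hB0 hE1 hE2 hE3 hE4 hdD.le hsep M (by omega)
    refine ⟨j, Finset.mem_Icc.2 ⟨hj1, by omega⟩, ?_⟩
    simp only [hf]
    exact le_of_mul_le_mul_right ((hM0 M (by omega)).trans hj3) (by positivity)
end

section
/- lim_{N→∞} (π/N) · ∑_{k=1}^{⌊5N/6⌋} log(2 sin(kπ/N)) = ∫_0^{5π/6} log(2 sin t) dt. -/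
open Filter Finset

noncomputable def rsS (N : ℕ) (t : ℝ) : ℝ := (⌈t / Real.pi * (N : ℝ)⌉₊ : ℝ) * Real.pi / (N : ℝ)

noncomputable def rsF (N : ℕ) (t : ℝ) : ℝ := Real.log (2 * Real.sin (rsS N t))

lemma rs_ceil (N : ℕ) (hN : 0 < N) (k : ℕ) (t : ℝ)
    (h1 : (k : ℝ) * Real.pi / N < t) (h2 : t ≤ ((k + 1 : ℕ) : ℝ) * Real.pi / N) :
    ⌈t / Real.pi * (N : ℝ)⌉₊ = k + 1 := by
  have hN' : (0 : ℝ) < N := by exact_mod_cast hN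
  have hp := Real.pi_pos
  rw [Nat.ceil_eq_iff (by omega)]
  rw [div_lt_iff₀ hN'] at h1
  rw [le_div_iff₀ hN'] at h2
  constructor
  · rw [div_mul_eq_mul_div, lt_div_iff₀ hp]; simpa using h1
  · rw [div_mul_eq_mul_div, div_le_iff₀ hp]; simpa using h2

lemma rs_meas (N : ℕ) : Measurable (rsF N) := by
  unfold rsF rsS
  have : Measurable (fun t : ℝ => (⌈t / Real.pi * (N : ℝ)⌉₊ : ℝ)) :=
    measurable_from_nat.comp (Nat.measurable_ceil.comp (by fun_prop))
  fun_prop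

lemma rs_sum (N : ℕ) (hN : 0 < N) (m : ℕ) :
    Real.pi / (N : ℝ) * ∑ k ∈ Finset.Icc 1 m, Real.log (2 * Real.sin ((k : ℝ) * Real.pi / (N : ℝ)))
      = ∫ t in (0:ℝ)..((m : ℝ) * Real.pi / N), rsF N t := by
  have hN' : (0 : ℝ) < N := by exact_mod_cast hN
  have hp := Real.pi_pos
  have hle : ∀ k : ℕ, (k : ℝ) * Real.pi / N ≤ ((k + 1 : ℕ) : ℝ) * Real.pi / N := by
    intro k
    gcongr
    omega
  have heq : ∀ k : ℕ, Set.EqOn (fun _ => Real.log (2 * Real.sin (((k + 1 : ℕ) : ℝ) * Real.pi / (N : ℝ))))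
      (rsF N) (Set.uIoc ((k : ℝ) * Real.pi / N) (((k + 1 : ℕ) : ℝ) * Real.pi / N)) := by
    intro k t ht
    rw [Set.uIoc_of_le (hle k)] at ht
    simp only [rsF, rsS, rs_ceil N hN k t ht.1 ht.2]
  have hsum := intervalIntegral.sum_integral_adjacent_intervals (μ := MeasureTheory.volume)
    (f := rsF N) (a := fun k : ℕ => (k : ℝ) * Real.pi / N) (n := m)
    (fun k _ => (intervalIntegrable_const).congr (heq k))
  simp only [Nat.cast_zero, zero_mul, zero_div] at hsum
  rw [← hsum, Finset.mul_sum, ← Finset.Ico_add_one_right_eq_Icc, Finset.sum_Ico_eq_sum_range]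
  refine Finset.sum_congr (by simp) fun k _ => ?_
  rw [← intervalIntegral.integral_congr_ae (Eventually.of_forall (heq k)), intervalIntegral.integral_const, smul_eq_mul,
    add_comm 1 k]
  congr 1
  push_cast
  ring

lemma rs_bound (N : ℕ) (hN : 0 < N) (t : ℝ) (h0 : 0 < t)
    (h1 : t ≤ ((5 * N / 6 : ℕ) : ℝ) * Real.pi / N) :
    |rsF N t| ≤ Real.log 2 + |Real.log (2 * Real.sin t)| := by
  have hN' : (0 : ℝ) < N := by exact_mod_cast hN
  have hp := Real.pi_pos
  have hts : t ≤ rsS N t := by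
    unfold rsS
    rw [le_div_iff₀ hN', ← div_le_iff₀ hp, ← div_mul_eq_mul_div]
    exact Nat.le_ceil _
  have hm : ((5 * N / 6 : ℕ) : ℝ) ≤ 5 * N / 6 := by
    have := @Nat.cast_div_le ℝ _ _ _ (5 * N) 6
    simpa using this
  have hs : rsS N t ≤ 5 * Real.pi / 6 := by
    have hc : ⌈t / Real.pi * (N : ℝ)⌉₊ ≤ 5 * N / 6 := by
      rw [Nat.ceil_le, div_mul_eq_mul_div, div_le_iff₀ hp]
      rwa [le_div_iff₀ hN'] at h1
    have hc' : (⌈t / Real.pi * (N : ℝ)⌉₊ : ℝ) ≤ 5 * N / 6 := le_trans (by exact_mod_cast hc) hm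
    unfold rsS
    rw [div_le_iff₀ hN']
    nlinarith
  unfold rsF
  set s := rsS N t
  have hst : 0 < Real.sin t := Real.sin_pos_of_pos_of_lt_pi h0 (by linarith)
  have hss : 0 < Real.sin s := Real.sin_pos_of_pos_of_lt_pi (by linarith) (by linarith)
  have hup : Real.log (2 * Real.sin s) ≤ Real.log 2 :=
    Real.log_le_log (by positivity) (by linarith [Real.sin_le_one s])
  have hl2 : 0 < Real.log 2 := Real.log_pos (by norm_num)
  have hlow : -|Real.log (2 * Real.sin t)| ≤ Real.log (2 * Real.sin s) := by
    rcases le_total s (Real.pi / 2) with h | h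
    · have : Real.sin t ≤ Real.sin s :=
        Real.sin_le_sin_of_le_of_le_pi_div_two (by linarith) h hts
      have h3 : Real.log (2 * Real.sin t) ≤ Real.log (2 * Real.sin s) :=
        Real.log_le_log (by positivity) (by linarith)
      linarith [neg_abs_le (Real.log (2 * Real.sin t))]
    · have : Real.sin (Real.pi / 6) ≤ Real.sin (Real.pi - s) :=
        Real.sin_le_sin_of_le_of_le_pi_div_two (by linarith) (by linarith) (by linarith)
      rw [Real.sin_pi_div_six, Real.sin_pi_sub] at this
      have : 0 ≤ Real.log (2 * Real.sin s) := Real.log_nonneg (by linarith)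
      linarith [abs_nonneg (Real.log (2 * Real.sin t))]
  rw [abs_le]
  constructor <;> linarith [abs_nonneg (Real.log (2 * Real.sin t))]

lemma rs_int : IntervalIntegrable (fun t => Real.log (2 * Real.sin t)) MeasureTheory.volume
    0 (5 * Real.pi / 6) := by
  have hp := Real.pi_pos
  have h : IntervalIntegrable (fun t => Real.log 2 + Real.log (Real.sin t)) MeasureTheory.volume
    0 (5 * Real.pi / 6) := intervalIntegrable_const.add intervalIntegrable_log_sin
  refine h.congr ?_
  intro t ht
  rw [Set.uIoc_of_le (by positivity)] at ht
  have hst : 0 < Real.sin t := Real.sin_pos_of_pos_of_lt_pi ht.1 (by linarith [ht.2])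
  simp only []
  rw [Real.log_mul (by norm_num) hst.ne']

theorem riemann_sum_log_sin :
    Filter.Tendsto
      (fun N : ℕ => Real.pi / (N : ℝ) *
        ∑ k ∈ Finset.Icc 1 (5 * N / 6), Real.log (2 * Real.sin ((k : ℝ) * Real.pi / (N : ℝ))))
      Filter.atTop
      (nhds (∫ t in (0:ℝ)..(5 * Real.pi / 6), Real.log (2 * Real.sin t))) := by
  have hp := Real.pi_pos
  have hcast : Tendsto (fun N : ℕ => (N : ℝ)) atTop atTop := tendsto_natCast_atTop_atTop
  rw [intervalIntegral.integral_of_le (by positivity), MeasureTheory.integral_Ioc_eq_integral_Ioo]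
  have key : Tendsto (fun N : ℕ => ∫ t in Set.Ioo 0 (5 * Real.pi / 6),
      (Set.Iic (((5 * N / 6 : ℕ) : ℝ) * Real.pi / N)).indicator (rsF N) t) atTop
      (nhds (∫ t in Set.Ioo 0 (5 * Real.pi / 6), Real.log (2 * Real.sin t))) := by
    apply MeasureTheory.tendsto_integral_filter_of_dominated_convergence
      (fun t => Real.log 2 + |Real.log (2 * Real.sin t)|)
    · exact Eventually.of_forall fun N =>
        ((rs_meas N).indicator measurableSet_Iic).aestronglyMeasurable
    · filter_upwards [eventually_gt_atTop 0] with N hN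
      refine (MeasureTheory.ae_restrict_iff' measurableSet_Ioo).2 (Eventually.of_forall ?_)
      intro t ht
      rw [Set.indicator_apply]
      split_ifs with h
      · exact rs_bound N hN t ht.1 h
      · rw [norm_zero]
        have hl2 : 0 < Real.log 2 := Real.log_pos (by norm_num)
        positivity
    · have h1 := ((intervalIntegrable_iff_integrableOn_Ioo_of_le (by positivity)).1 rs_int)
      have h2 : MeasureTheory.IntegrableOn (fun _ : ℝ => Real.log 2) (Set.Ioo 0 (5 * Real.pi / 6)) :=
        MeasureTheory.integrableOn_const (by simp)
      exact MeasureTheory.Integrable.add h2 h1.abs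
    · refine (MeasureTheory.ae_restrict_iff' measurableSet_Ioo).2 (Eventually.of_forall ?_)
      intro t ht
      have hst : 0 < Real.sin t := Real.sin_pos_of_pos_of_lt_pi ht.1 (by linarith [ht.2])
      have hS : Tendsto (fun N : ℕ => rsS N t) atTop (nhds t) := by
        have := ((tendsto_nat_ceil_mul_div_atTop (R := ℝ) (a := t / Real.pi)
          (div_nonneg ht.1.le hp.le)).comp hcast).mul_const Real.pi
        rw [div_mul_cancel₀ _ hp.ne'] at this
        refine this.congr fun N => ?_
        simp only [rsS, Function.comp]
        ring
      have hM : Tendsto (fun N : ℕ => ((5 * N / 6 : ℕ) : ℝ) * Real.pi / N) atTop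
          (nhds (5 * Real.pi / 6)) := by
        have := ((tendsto_nat_floor_mul_div_atTop (R := ℝ) (a := 5 / 6)
          (by norm_num)).comp hcast).mul_const Real.pi
        rw [show (5 / 6 : ℝ) * Real.pi = 5 * Real.pi / 6 by ring] at this
        refine this.congr fun N => ?_
        have hf : ⌊(5 / 6 : ℝ) * N⌋₊ = 5 * N / 6 := by
          rw [show (5 / 6 : ℝ) * N = ((5 * N : ℕ) : ℝ) / ((6 : ℕ) : ℝ) by push_cast; ring]
          exact Nat.floor_div_eq_div _ _
        simp only [Function.comp, hf]
        ring
      have hF : Tendsto (fun N : ℕ => rsF N t) atTop (nhds (Real.log (2 * Real.sin t))) := by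
        unfold rsF
        have hc : ContinuousAt (fun x => Real.log (2 * Real.sin x)) t :=
          ContinuousAt.log (by fun_prop) (by positivity)
        exact hc.tendsto.comp hS
      refine hF.congr' ?_
      filter_upwards [hM.eventually (lt_mem_nhds ht.2)] with N hN
      rw [Set.indicator_of_mem (show t ∈ Set.Iic _ from le_of_lt hN)]
  refine key.congr' ?_
  filter_upwards [eventually_gt_atTop 0] with N hN
  have hN' : (0 : ℝ) < N := by exact_mod_cast hN
  have hm : ((5 * N / 6 : ℕ) : ℝ) ≤ 5 * N / 6 := by
    have := @Nat.cast_div_le ℝ _ _ _ (5 * N) 6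
    simpa using this
  rw [rs_sum N hN, intervalIntegral.integral_of_le (by positivity),
    ← MeasureTheory.integral_Ioc_eq_integral_Ioo,
    MeasureTheory.setIntegral_indicator measurableSet_Iic, Set.Ioc_inter_Iic, min_eq_right]
  rw [div_le_iff₀ hN']
  nlinarith
end
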